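/- arXiv:math/0403552 — 11 statements merged into one kernel-verified Lean document; each statement's English description precedes it below -/
import Mathlib

section
/- Let H be an infinite-dimensional separable real Hilbert space, let A₀ : H → H be a bounded invertible linear operator, and let r₁ > 0. Then there exist a number r₀ ∈ (0, r₁) and a smooth diffeomorphism φ : H → H such that φ(u) = u for every u with ‖u‖ ≥ r₁, and φ(u) = A₀u for every u with ‖u‖ ≤ r₀. -/
section alg
variable {H K : Type*} [NormedAddCommGroup H] [NormedSpace ℝ H] [NormedAddCommGroup K] [NormedSpace ℝ K]

theorem ug_left {P : (H →L[ℝ] H) → Prop} (hmul : ∀ A B, P A → P B → P (A * B))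
    (hN : ∀ N : H →L[ℝ] H, N * N = 0 → P (1 + N)) (N A : H →L[ℝ] H) (h : N * N = 0)
    (hA : P ((1 + N) * A)) : P A := by
  have h1 := hmul _ _ (hN (-N) (by simpa using h)) hA
  have : (1 + -N) * ((1 + N) * A) = A := by
    have : (1 + -N) * ((1 + N) * A) = A - (N * N) * A := by noncomm_ring
    rw [this, h]; simp
  rwa [this] at h1

theorem ug_right {P : (H →L[ℝ] H) → Prop} (hmul : ∀ A B, P A → P B → P (A * B))
    (hN : ∀ N : H →L[ℝ] H, N * N = 0 → P (1 + N)) (N A : H →L[ℝ] H) (h : N * N = 0)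
    (hA : P (A * (1 + N))) : P A := by
  have h1 := hmul _ _ hA (hN (-N) (by simpa using h))
  have : (A * (1 + N)) * (1 + -N) = A := by
    have : (A * (1 + N)) * (1 + -N) = A - A * (N * N) := by noncomm_ring
    rw [this, h]; simp
  rwa [this] at h1

/-- Whitehead's lemma. -/
theorem ug_whitehead {P : (H →L[ℝ] H) → Prop} (hmul : ∀ A B, P A → P B → P (A * B))
    (hN : ∀ N : H →L[ℝ] H, N * N = 0 → P (1 + N))
    (V W : K →L[ℝ] H) (Vs Ws : H →L[ℝ] K) (X Y : K →L[ℝ] K)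
    (h1 : ∀ x, Vs (V x) = x) (h2 : ∀ x, Ws (W x) = x) (h3 : ∀ x, Vs (W x) = 0)
    (h4 : ∀ x, Ws (V x) = 0) (hXY : ∀ x, X (Y x) = x) (hYX : ∀ x, Y (X x) = x) :
    P (1 + V ∘L (X - 1) ∘L Vs + W ∘L (Y - 1) ∘L Ws) := by
  have e12 : ∀ Z : K →L[ℝ] K, P (1 + V ∘L Z ∘L Ws) := fun Z => hN _ (by ext x; simp [h4])
  have e21 : ∀ Z : K →L[ℝ] K, P (1 + W ∘L Z ∘L Vs) := fun Z => hN _ (by ext x; simp [h3])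
  have := hmul _ _ (e12 X) (hmul _ _ (e21 (-Y)) (hmul _ _ (e12 X) (hmul _ _ (e12 (-1))
    (hmul _ _ (e21 1) (e12 (-1))))))
  convert! this using 1
  ext x
  simp [h1, h2, h3, h4, hXY, hYX]
  abel

/-- One step: moving the range of `X` to the range of `W`. -/
theorem ug_move {P : (H →L[ℝ] H) → Prop} (hmul : ∀ A B, P A → P B → P (A * B))
    (hN : ∀ N : H →L[ℝ] H, N * N = 0 → P (1 + N)) (A : H →L[ℝ] H) (B : H →L[ℝ] H)
    (hBA : ∀ x, B (A x) = x) (hAB : ∀ x, A (B x) = x)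
    (V W : K →L[ℝ] H) (Vs Ws : H →L[ℝ] K)
    (h1 : ∀ x, Vs (V x) = x) (h2 : ∀ x, Ws (W x) = x)
    (h4 : ∀ x, Ws (A (V x)) = 0)
    (hred : ∀ A' B' : H →L[ℝ] H, (∀ x, B' (A' x) = x) → (∀ x, A' (B' x) = x) →
      (∀ x, A' (V x) = W x) → P A') : P A := by
  set L : H →L[ℝ] K := Vs ∘L B ∘L (1 - W ∘L Ws) with hL
  have hLX : ∀ x, L (A (V x)) = x := fun x => by simp [hL, h4, hBA, h1]
  have hLW : ∀ x, L (W x) = 0 := fun x => by simp [hL, h2]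
  clear_value L
  have n1 : (W ∘L L) * (W ∘L L) = 0 := by ext x; simp [hLW]
  have n2 : (-(A ∘L V ∘L Ws)) * (-(A ∘L V ∘L Ws)) = 0 := by ext x; simp [h4]
  refine ug_left hmul hN _ _ n1 (ug_left hmul hN _ _ n2 ?_)
  refine hred _ (B * ((1 - W ∘L L) * (1 + (A ∘L V ∘L Ws)))) ?_ ?_ ?_
  · intro x; simp [hLW, h4, h2, hLX, hBA, hAB]; try abel
  · intro x; simp [hLW, h4, h2, hLX, hBA, hAB]; try abel
  · intro x; simp [hLW, h4, h2, hLX, hBA, hAB]; try abel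

theorem ug_diag {P : (H →L[ℝ] H) → Prop} (hmul : ∀ A B, P A → P B → P (A * B))
    (hN : ∀ N : H →L[ℝ] H, N * N = 0 → P (1 + N)) (A : H →L[ℝ] H) (B : H →L[ℝ] H)
    (hBA : ∀ x, B (A x) = x) (hAB : ∀ x, A (B x) = x)
    (V : K →L[ℝ] H) (Vs : H →L[ℝ] K)
    (h1 : ∀ x, Vs (V x) = x) (hAV : ∀ x, A (V x) = V x)
    (hred : ∀ A' B' : H →L[ℝ] H, (∀ x, B' (A' x) = x) → (∀ x, A' (B' x) = x) →
      (∀ x, A' (V x) = V x) → (∀ x, Vs (A' x) = Vs x) → P A') : P A := by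
  set N : H →L[ℝ] H := V ∘L Vs ∘L A ∘L (1 - V ∘L Vs) with hNd
  have hNV : ∀ x, N (V x) = 0 := fun x => by simp [hNd, h1]
  have hNN : ∀ x, N (N x) = 0 := fun x => by
    have : N x = V (Vs (A (x - V (Vs x)))) := by simp [hNd]
    rw [this, hNV]
  refine ug_right hmul hN (-N) A (by ext x; simp [hNN]) ?_
  refine hred _ ((1 + N) * B) ?_ ?_ ?_ ?_
  · intro x; simp [hNN, hBA, hAB]
  · intro x; simp [hNN, hBA, hAB]
  · intro x; simp [hNV, hAV]
  · intro x; simp [hNd, h1, hAV]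
end alg

section hilb
open RealInnerProductSpace
variable {H G : Type*} [NormedAddCommGroup H] [InnerProductSpace ℝ H] [CompleteSpace H]
  [NormedAddCommGroup G] [InnerProductSpace ℝ G] [CompleteSpace G]

noncomputable def ugD (a : G →L[ℝ] G) : lp (fun _ : ℕ => G) 2 →L[ℝ] lp (fun _ : ℕ => G) 2 :=
  lp.mapCLM 2 (fun _ => a) (norm_nonneg a) (fun _ => le_rfl)

theorem ugD_apply (a : G →L[ℝ] G) (f) (n : ℕ) : ugD a f n = a (f n) := rfl

theorem ug_adj_apply {T : ℕ → G →ₗᵢ[ℝ] H} (hT : OrthogonalFamily ℝ (fun _ : ℕ => G) T) (h : H) (n : ℕ) :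
    (hT.linearIsometry.toContinuousLinearMap.adjoint h) n
      = (T n).toContinuousLinearMap.adjoint h := by
  refine ext_inner_right ℝ fun g => ?_
  rw [← lp.inner_single_right (𝕜 := ℝ), ContinuousLinearMap.adjoint_inner_left,
    ContinuousLinearMap.adjoint_inner_left]
  simp

theorem ug_adj_self {K : Type*} [NormedAddCommGroup K] [InnerProductSpace ℝ K] [CompleteSpace K]
    (V : K →ₗᵢ[ℝ] H) (x : K) :
    V.toContinuousLinearMap.adjoint (V x) = x := by
  refine ext_inner_right ℝ fun g => ?_
  rw [ContinuousLinearMap.adjoint_inner_left]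
  simp

theorem ug_adj_ortho {S T : ℕ → G →ₗᵢ[ℝ] H} (hS : OrthogonalFamily ℝ (fun _ : ℕ => G) S)
    (hT : OrthogonalFamily ℝ (fun _ : ℕ => G) T) (hST : ∀ i j x y, ⟪S i x, T j y⟫ = 0) (f) :
    hS.linearIsometry.toContinuousLinearMap.adjoint (hT.linearIsometry f) = 0 := by
  ext n
  rw [ug_adj_apply]
  refine ext_inner_left ℝ fun g => ?_
  rw [ContinuousLinearMap.adjoint_inner_right]
  have := (hT.hasSum_linearIsometry f).mapL (innerSL ℝ (S n g))
  simp only [innerSL_apply_apply, hST] at this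
  simpa using this.unique hasSum_zero

theorem ug_swindle {P : (H →L[ℝ] H) → Prop} (hmul : ∀ A B, P A → P B → P (A * B))
    (hN : ∀ N : H →L[ℝ] H, N * N = 0 → P (1 + N))
    {T : ℕ → G →ₗᵢ[ℝ] H} (hT : OrthogonalFamily ℝ (fun _ : ℕ => G) T) (a b : G →L[ℝ] G)
    (hab : ∀ x, a (b x) = x) (hba : ∀ x, b (a x) = x) :
    P (1 + (T 0).toContinuousLinearMap ∘L (a - 1) ∘L (T 0).toContinuousLinearMap.adjoint) := by
  have hE : OrthogonalFamily ℝ (fun _ : ℕ => G) (fun n => T (2 * n)) :=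
    hT.comp (γ := ℕ) (f := fun n => 2 * n) (fun x y h => by simpa using h)
  have hV : OrthogonalFamily ℝ (fun _ : ℕ => G) (fun n => T (2 * n + 2)) :=
    hT.comp (γ := ℕ) (f := fun n => 2 * n + 2) (fun x y h => by simpa using h)
  have hW : OrthogonalFamily ℝ (fun _ : ℕ => G) (fun n => T (2 * n + 1)) :=
    hT.comp (γ := ℕ) (f := fun n => 2 * n + 1) (fun x y h => by simpa using h)
  have hDab : ∀ f, ugD a (ugD b f) = f := fun f => by ext n; simp [ugD_apply, hab]
  have hDba : ∀ f, ugD b (ugD a f) = f := fun f => by ext n; simp [ugD_apply, hba]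
  have c1 := ug_whitehead hmul hN hE.linearIsometry.toContinuousLinearMap
    hW.linearIsometry.toContinuousLinearMap hE.linearIsometry.toContinuousLinearMap.adjoint
    hW.linearIsometry.toContinuousLinearMap.adjoint (ugD a) (ugD b)
    (ug_adj_self _) (ug_adj_self _)
    (ug_adj_ortho hE hW fun i j x y => hT (by omega) x y)
    (ug_adj_ortho hW hE fun i j x y => hT (by omega) x y) hDab hDba
  have hVW := (ug_adj_ortho hV hW fun i j x y => hT (by omega) x y)
  have hWV := (ug_adj_ortho hW hV fun i j x y => hT (by omega) x y)
  have c2 := ug_whitehead hmul hN hV.linearIsometry.toContinuousLinearMap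
    hW.linearIsometry.toContinuousLinearMap hV.linearIsometry.toContinuousLinearMap.adjoint
    hW.linearIsometry.toContinuousLinearMap.adjoint (ugD b) (ugD a)
    (ug_adj_self _) (ug_adj_self _) hVW hWV hDba hDab
  have h0V : ∀ f, (T 0).toContinuousLinearMap.adjoint (hV.linearIsometry f) = 0 := by
    intro f
    refine ext_inner_left ℝ fun g => ?_
    rw [ContinuousLinearMap.adjoint_inner_right]
    have := (hV.hasSum_linearIsometry f).mapL (innerSL ℝ (T 0 g))
    simp only [innerSL_apply_apply, fun n x => hT (show 0 ≠ 2 * n + 2 by omega) g x] at this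
    simpa using this.unique hasSum_zero
  have h0W : ∀ f, (T 0).toContinuousLinearMap.adjoint (hW.linearIsometry f) = 0 := by
    intro f
    refine ext_inner_left ℝ fun g => ?_
    rw [ContinuousLinearMap.adjoint_inner_right]
    have := (hW.hasSum_linearIsometry f).mapL (innerSL ℝ (T 0 g))
    simp only [innerSL_apply_apply, fun n x => hT (show 0 ≠ 2 * n + 1 by omega) g x] at this
    simpa using this.unique hasSum_zero
  have key : ∀ x, hE.linearIsometry
      ((ugD a - 1) (hE.linearIsometry.toContinuousLinearMap.adjoint x)) =
      T 0 ((a - 1) ((T 0).toContinuousLinearMap.adjoint x)) +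
      hV.linearIsometry ((ugD a - 1) (hV.linearIsometry.toContinuousLinearMap.adjoint x)) := by
    intro x
    have s1 := hE.hasSum_linearIsometry
      ((ugD a - 1) (hE.linearIsometry.toContinuousLinearMap.adjoint x))
    have s2 := hV.hasSum_linearIsometry
      ((ugD a - 1) (hV.linearIsometry.toContinuousLinearMap.adjoint x))
    have hc : ∀ (f : lp (fun _ : ℕ => G) 2) n, ((ugD a - 1) f) n = (a - 1) (f n) := fun f n => rfl
    simp only [hc, ug_adj_apply] at s1 s2
    rw [← hasSum_nat_add_iff' 1] at s1
    have := s1.unique s2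
    rw [Finset.sum_range_one] at this
    rw [← this]
    simp
  have := hmul _ _ c1 c2
  convert! this using 1
  have hVV := ug_adj_self hV.linearIsometry
  have hWW := ug_adj_self hW.linearIsometry
  generalize hV.linearIsometry = V at *
  generalize hW.linearIsometry = W at *
  generalize hE.linearIsometry = E at *
  ext x
  have k := key ((1 + V.toContinuousLinearMap ∘L (ugD b - 1) ∘L V.toContinuousLinearMap.adjoint +
    W.toContinuousLinearMap ∘L (ugD a - 1) ∘L W.toContinuousLinearMap.adjoint) x)
  simp only [mul_apply_eq_comp, add_apply,
    ContinuousLinearMap.comp_apply, LinearIsometry.coe_toContinuousLinearMap] at k ⊢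
  rw [k]
  simp [h0V, h0W, hVV, hWW, hVW, hWV, hDab, hDba]
  abel
end hilb

section diffeo
open RealInnerProductSpace
variable {H : Type*} [NormedAddCommGroup H] [InnerProductSpace ℝ H] [CompleteSpace H]

def UGGood (r₁ : ℝ) (A : H →L[ℝ] H) : Prop :=
  ∃ (r₀ : ℝ) (φ φinv : H → H), 0 < r₀ ∧ r₀ < r₁ ∧
      ContDiff ℝ (⊤ : ℕ∞) φ ∧ ContDiff ℝ (⊤ : ℕ∞) φinv ∧
      Function.LeftInverse φinv φ ∧ Function.RightInverse φinv φ ∧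
      (∀ u : H, r₁ ≤ ‖u‖ → φ u = u) ∧
      (∀ u : H, ‖u‖ ≤ r₀ → φ u = A u)

theorem UGGood.mul {r₁ : ℝ} (A B : H →L[ℝ] H) (hA : UGGood r₁ A) (hB : UGGood r₁ B) :
    UGGood r₁ (A * B) := by
  obtain ⟨r, φ, φi, hr, hr1, c1, c2, l, rr, o, i⟩ := hA
  obtain ⟨s, ψ, ψi, hs, hs1, d1, d2, l', rr', o', i'⟩ := hB
  have hb : 0 < ‖B‖ + 1 := by positivity
  refine ⟨min s (r / (‖B‖ + 1)), φ ∘ ψ, ψi ∘ φi, lt_min hs (by positivity),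
    (min_le_left _ _).trans_lt hs1, c1.comp d1, d2.comp c2, l.comp l', rr.comp rr', ?_, ?_⟩
  · intro u hu
    simp [o' u hu, o u hu]
  · intro u hu
    rw [Function.comp_apply, i' u (hu.trans (min_le_left _ _)), i]
    · rfl
    · have h1 : ‖u‖ ≤ r / (‖B‖ + 1) := hu.trans (min_le_right _ _)
      rw [le_div_iff₀ hb] at h1
      have := B.le_opNorm u
      nlinarith [norm_nonneg u]

theorem UGGood.small (r₁ : ℝ) (hr : 0 < r₁) :
    ∃ ε > 0, ∀ N : H →L[ℝ] H, ‖N‖ < ε → UGGood r₁ (1 + N) := by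
  let χ : ContDiffBump (0 : ℝ) := ⟨(r₁ / 2) ^ 2, r₁ ^ 2, by positivity, by nlinarith⟩
  have hχ : ContDiff ℝ (⊤ : ℕ∞) χ := χ.contDiff
  have hχd : Differentiable ℝ χ := hχ.differentiable (by simp)
  have hcs : HasCompactSupport (fun t => deriv χ t * t) := (χ.hasCompactSupport.deriv).mul_right
  obtain ⟨M, hM⟩ := hcs.exists_bound_of_continuous
    (((hχ.continuous_deriv (by simp))).mul continuous_id)
  have hM0 : 0 ≤ M := (norm_nonneg _).trans (hM 0)
  refine ⟨1 / (2 * (1 + 2 * M)), by positivity, fun N hNs => ?_⟩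
  set f : H → H := fun u => χ (‖u‖ ^ 2) • N u with hf
  have hfc : ContDiff ℝ (⊤ : ℕ∞) f := (hχ.comp (contDiff_norm_sq ℝ)).smul N.contDiff
  let f' : H → H →L[ℝ] H := fun u => χ (‖u‖ ^ 2) • N +
    ((deriv χ (‖u‖ ^ 2)) • ((2 : ℝ) • innerSL ℝ u)).smulRight (N u)
  have hf' : ∀ u, HasFDerivAt f (f' u) u := by
    intro u
    have h1 : HasFDerivAt (fun u : H => ‖u‖ ^ 2) ((2 : ℝ) • innerSL ℝ u) u := by
      have h0 := (hasStrictFDerivAt_norm_sq u).hasFDerivAt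
      rwa [← Nat.cast_smul_eq_nsmul ℝ] at h0
    exact ((hχd _).hasDerivAt.comp_hasFDerivAt u h1).smul N.hasFDerivAt
  have hbd : ∀ u, ‖f' u‖ ≤ 1 / 2 := by
    intro u
    have h1 : ‖χ (‖u‖ ^ 2) • N‖ ≤ ‖N‖ := by
      rw [norm_smul, Real.norm_of_nonneg χ.nonneg]
      exact mul_le_of_le_one_left (norm_nonneg _) χ.le_one
    have h2 : ‖((deriv χ (‖u‖ ^ 2)) • ((2 : ℝ) • innerSL ℝ u)).smulRight (N u)‖
        ≤ 2 * M * ‖N‖ := by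
      rw [ContinuousLinearMap.norm_smulRight_apply, norm_smul, norm_smul, innerSL_apply_norm]
      have := hM (‖u‖ ^ 2)
      simp only [norm_mul, norm_pow, norm_norm] at this
      calc _ ≤ ‖deriv χ (‖u‖ ^ 2)‖ * (‖(2 : ℝ)‖ * ‖u‖) * (‖N‖ * ‖u‖) := by
            gcongr; exact N.le_opNorm u
        _ = 2 * (‖deriv χ (‖u‖ ^ 2)‖ * ‖u‖ ^ 2) * ‖N‖ := by norm_num; ring
        _ ≤ _ := by gcongr
    have h3 := norm_add_le (χ (‖u‖ ^ 2) • N)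
      (((deriv χ (‖u‖ ^ 2)) • ((2 : ℝ) • innerSL ℝ u)).smulRight (N u))
    rw [lt_div_iff₀ (by positivity)] at hNs
    show ‖_ + _‖ ≤ _
    linarith
  have hlip : LipschitzWith (1 / 2) f :=
    lipschitzWith_of_nnnorm_fderiv_le (fun u => (hf' u).differentiableAt) fun u => by
      rw [(hf' u).fderiv, ← NNReal.coe_le_coe]; simpa using hbd u
  let φ : H → H := fun u => u + f u
  have happ : ApproximatesLinearOn φ ((ContinuousLinearEquiv.refl ℝ H : H ≃L[ℝ] H) : H →L[ℝ] H)
      Set.univ (1 / 2) := by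
    apply LipschitzOnWith.approximatesLinearOn
    rw [lipschitzOnWith_univ]
    convert hlip using 1
    ext u; simp [φ]
  have hcond : Subsingleton H ∨ (1 / 2 : NNReal) <
      ‖((ContinuousLinearEquiv.refl ℝ H).symm : H →L[ℝ] H)‖₊⁻¹ := by
    rcases subsingleton_or_nontrivial H with h | h
    · exact Or.inl h
    · right
      have : ‖((ContinuousLinearEquiv.refl ℝ H).symm : H →L[ℝ] H)‖₊ = 1 := by
        ext; exact ContinuousLinearMap.norm_id
      rw [this, ← NNReal.coe_lt_coe]; norm_num
  let Φ : H ≃ₜ H := happ.toHomeomorph φ hcond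
  have hΦ : (Φ : H → H) = φ := rfl
  have hφc : ContDiff ℝ (⊤ : ℕ∞) φ := contDiff_id.add hfc
  have hlt : ∀ u, ‖-(f' u)‖ < 1 := fun u => by rw [norm_neg]; linarith [hbd u]
  let g : H → H ≃L[ℝ] H := fun u =>
    ContinuousLinearEquiv.unitsEquiv ℝ H (Units.oneSub (-(f' u)) (hlt u))
  have hg : ∀ u, HasFDerivAt Φ (g u : H →L[ℝ] H) u := by
    intro u
    have := (hasFDerivAt_id u).add (hf' u)
    rw [hΦ]
    convert! this using 1
    ext v
    simp [g]
  refine ⟨r₁ / 2, φ, Φ.symm, by positivity, by linarith, hφc, Φ.contDiff_symm hg hφc,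
    Φ.symm_apply_apply, Φ.apply_symm_apply, ?_, ?_⟩
  · intro u hu
    have : χ (‖u‖ ^ 2) = 0 := χ.zero_of_le_dist (by
      simp only [dist_zero_right, norm_pow, norm_norm]
      show r₁ ^ 2 ≤ _
      gcongr)
    simp [φ, hf, this]
  · intro u hu
    have : χ (‖u‖ ^ 2) = 1 := χ.one_of_mem_closedBall (by
      simp only [mem_closedBall_zero_iff, norm_pow, norm_norm]
      show _ ≤ (r₁ / 2) ^ 2
      gcongr)
    simp [φ, hf, this]

theorem UGGood.unip {r₁ : ℝ} (hr : 0 < r₁) (N : H →L[ℝ] H) (hN : N * N = 0) :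
    UGGood r₁ (1 + N) := by
  obtain ⟨ε, hε, h⟩ := UGGood.small (H := H) r₁ hr
  obtain ⟨n, hn⟩ := exists_nat_gt (‖N‖ / ε)
  have hn0 : (0 : ℝ) < n := lt_of_le_of_lt (by positivity) hn
  have hk : ∀ k : ℕ, UGGood r₁ (1 + ((k : ℝ) / n) • N) := by
    intro k
    induction k with
    | zero => simpa using h 0 (by simpa using hε)
    | succ k ih =>
      have := UGGood.mul _ _ ih (h ((1 / (n : ℝ)) • N) (by
        rw [norm_smul, Real.norm_of_nonneg (by positivity)]
        rw [div_lt_iff₀ hε] at hn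
        field_simp
        linarith))
      convert! this using 1
      rw [mul_add, add_mul, add_mul, smul_mul_smul_comm, hN, smul_zero, one_mul, mul_one, one_mul,
        add_zero, add_assoc, ← add_smul]
      congr 2
      push_cast; ring
  have := hk n
  rwa [div_self hn0.ne', one_smul] at this
end diffeo

section final
open RealInnerProductSpace
variable {H : Type*} [NormedAddCommGroup H] [InnerProductSpace ℝ H] [CompleteSpace H]

theorem ug_exists_unit (hH : ¬ FiniteDimensional ℝ H) (s : Finset H) :
    ∃ y : H, ‖y‖ = 1 ∧ ∀ x ∈ s, ⟪x, y⟫ = 0 := by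
  set E := Submodule.span ℝ (s : Set H) with hE
  have hfd : FiniteDimensional ℝ E := FiniteDimensional.span_finset ℝ s
  have hne : Eᗮ ≠ ⊥ := by
    intro h
    rw [Submodule.orthogonal_eq_bot_iff] at h
    rw [h] at hfd
    exact hH (Module.Finite.of_surjective (⊤ : Submodule ℝ H).subtype
      (fun x => ⟨⟨x, trivial⟩, rfl⟩))
  obtain ⟨y, hy, hy0⟩ := Submodule.exists_mem_ne_zero_of_ne_bot hne
  refine ⟨(‖y‖⁻¹ : ℝ) • y, ?_, fun x hx => ?_⟩
  · rw [norm_smul, norm_inv, norm_norm, inv_mul_cancel₀ (norm_ne_zero_iff.2 hy0)]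
  · rw [inner_smul_right, (Submodule.mem_orthogonal E y).1 hy x (Submodule.subset_span hx), mul_zero]

theorem ug_exists_seq (hH : ¬ FiniteDimensional ℝ H) (A : H →L[ℝ] H) :
    ∃ e f : ℕ → H, Orthonormal ℝ e ∧ Orthonormal ℝ f ∧ (∀ i j, ⟪f i, e j⟫ = 0) ∧
      (∀ i j, ⟪f i, A (e j)⟫ = 0) := by
  classical
  obtain ⟨p, hp, hr⟩ := exists_seq_of_forall_finset_exists
    (fun p : H × H => ‖p.1‖ = 1 ∧ ‖p.2‖ = 1 ∧ ⟪p.2, p.1⟫ = 0 ∧ ⟪p.2, A p.1⟫ = 0)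
    (fun p q : H × H => ⟪p.1, q.1⟫ = 0 ∧ ⟪p.2, q.2⟫ = 0 ∧ ⟪p.2, q.1⟫ = 0 ∧ ⟪p.2, A q.1⟫ = 0 ∧
      ⟪q.2, p.1⟫ = 0 ∧ ⟪q.2, A p.1⟫ = 0) (by
    intro s hs
    obtain ⟨e, he, he'⟩ := ug_exists_unit hH
      (s.image Prod.fst ∪ s.image Prod.snd ∪ s.image (fun p => A.adjoint p.2))
    obtain ⟨f, hf, hf'⟩ := ug_exists_unit hH
      (s.image Prod.fst ∪ s.image Prod.snd ∪ s.image (fun p => A p.1) ∪ {e, A e})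
    refine ⟨(e, f), ⟨he, hf, ?_, ?_⟩, fun x hx => ⟨?_, ?_, ?_, ?_, ?_, ?_⟩⟩
    · rw [real_inner_comm]; exact hf' _ (by simp)
    · rw [real_inner_comm]; exact hf' _ (by simp)
    · exact he' _ (by simp only [Finset.mem_union, Finset.mem_image]; exact Or.inl (Or.inl ⟨x, hx, rfl⟩))
    · exact hf' _ (by
        simp only [Finset.mem_union, Finset.mem_image]; exact Or.inl (Or.inl (Or.inr ⟨x, hx, rfl⟩)))
    · exact he' _ (by simp only [Finset.mem_union, Finset.mem_image]; exact Or.inl (Or.inr ⟨x, hx, rfl⟩))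
    · rw [← ContinuousLinearMap.adjoint_inner_left]
      exact he' _ (by simp only [Finset.mem_union, Finset.mem_image]; exact Or.inr ⟨x, hx, rfl⟩)
    · rw [real_inner_comm]
      exact hf' _ (by
        simp only [Finset.mem_union, Finset.mem_image]; exact Or.inl (Or.inl (Or.inl ⟨x, hx, rfl⟩)))
    · rw [real_inner_comm]
      exact hf' _ (by
        simp only [Finset.mem_union, Finset.mem_image]; exact Or.inl (Or.inr ⟨x, hx, rfl⟩)))
  refine ⟨fun n => (p n).1, fun n => (p n).2, ⟨fun n => (hp n).1, fun i j hij => ?_⟩,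
    ⟨fun n => (hp n).2.1, fun i j hij => ?_⟩, fun i j => ?_, fun i j => ?_⟩
  · rcases lt_or_gt_of_ne hij with h | h
    · exact (hr i j h).1
    · rw [real_inner_comm]; exact (hr j i h).1
  · rcases lt_or_gt_of_ne hij with h | h
    · exact (hr i j h).2.1
    · rw [real_inner_comm]; exact (hr j i h).2.1
  · rcases lt_trichotomy i j with h | h | h
    · exact (hr i j h).2.2.1
    · subst h; exact (hp i).2.2.1
    · exact (hr j i h).2.2.2.2.1
  · rcases lt_trichotomy i j with h | h | h
    · exact (hr i j h).2.2.2.1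
    · subst h; exact (hp i).2.2.2
    · exact (hr j i h).2.2.2.2.2

/-- The isometry from `ℓ²` given by an orthonormal family. -/
noncomputable def ugIso {ι : Type*} {v : ι → H} (hv : Orthonormal ℝ v) :
    lp (fun _ : ι => ℝ) 2 →ₗᵢ[ℝ] H := hv.orthogonalFamily.linearIsometry

theorem ugIso_hasSum {ι : Type*} {v : ι → H} (hv : Orthonormal ℝ v) (x) :
    HasSum (fun i => x i • v i) (ugIso hv x) := by
  simpa [ugIso] using hv.orthogonalFamily.hasSum_linearIsometry x

theorem ugIso_single {ι : Type*} [DecidableEq ι] {v : ι → H} (hv : Orthonormal ℝ v) (i) :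
    ugIso hv (lp.single 2 i 1) = v i := by
  simp [ugIso]

theorem ugIso_zero {ι : Type*} {v : ι → H} (hv : Orthonormal ℝ v) (x) (L : H →L[ℝ] ℝ)
    (hL : ∀ i, L (v i) = 0) : L (ugIso hv x) = 0 := by
  have := (ugIso_hasSum hv x).mapL L
  simp only [map_smul, hL, smul_zero] at this
  exact this.unique hasSum_zero

theorem ugIso_adj_zero {ι κ : Type*} {v : ι → H} (hv : Orthonormal ℝ v) {w : κ → H}
    (hw : Orthonormal ℝ w) (B : H →L[ℝ] H) (h : ∀ i j, ⟪w i, B (v j)⟫ = 0) (x) :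
    (ugIso hw).toContinuousLinearMap.adjoint (B (ugIso hv x)) = 0 := by
  refine ext_inner_left ℝ fun g => ?_
  rw [ContinuousLinearMap.adjoint_inner_right, inner_zero_right]
  refine ugIso_zero hv x (innerSL ℝ (ugIso hw g) ∘L B) fun j => ?_
  show ⟪ugIso hw g, B (v j)⟫ = 0
  rw [real_inner_comm]
  exact ugIso_zero hw g (innerSL ℝ (B (v j))) fun i => by
    show ⟪B (v j), w i⟫ = 0
    rw [real_inner_comm]; exact h i j

theorem ug_countable [TopologicalSpace.SeparableSpace H] {ι : Type*} {v : ι → H}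
    (hv : Orthonormal ℝ v) : Countable ι := by
  have hd : Pairwise fun i j => Disjoint (Metric.ball (v i) (1 / 2)) (Metric.ball (v j) (1 / 2)) := by
    intro i j hij
    apply Metric.ball_disjoint_ball
    rw [dist_eq_norm]
    have h1 := norm_sub_sq_real (v i) (v j)
    rw [hv.2 hij, hv.1 i, hv.1 j] at h1
    nlinarith [norm_nonneg (v i - v j)]
  exact hd.countable_of_isOpen_disjoint (fun _ => Metric.isOpen_ball)
    (fun i => ⟨v i, Metric.mem_ball_self (by norm_num)⟩)

theorem ug_block [TopologicalSpace.SeparableSpace H]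
    {P : (H →L[ℝ] H) → Prop} (hmul : ∀ A B, P A → P B → P (A * B))
    (hN : ∀ N : H →L[ℝ] H, N * N = 0 → P (1 + N)) {e : ℕ → H} (he : Orthonormal ℝ e)
    (A B : H →L[ℝ] H) (hBA : ∀ x, B (A x) = x) (hAB : ∀ x, A (B x) = x)
    (h1 : ∀ x, A (ugIso he x) = ugIso he x)
    (h2 : ∀ x, (ugIso he).toContinuousLinearMap.adjoint (A x) =
      (ugIso he).toContinuousLinearMap.adjoint x) : P A := by
  have hVV := ug_adj_self (ugIso he)
  set Vs := (ugIso he).toContinuousLinearMap.adjoint with hVs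
  have h1' : ∀ x, B (ugIso he x) = ugIso he x := fun x => by
    conv_lhs => rw [← h1 x]
    rw [hBA]
  have h2' : ∀ x, Vs (B x) = Vs x := fun x => by rw [← h2 (B x), hAB]
  let G : Submodule ℝ H := Vs.ker
  have hGc : IsClosed (G : Set H) := Vs.isClosed_ker
  haveI : CompleteSpace G := hGc.completeSpace_coe
  have hG : ∀ g : G, Vs g = 0 := fun g => g.2
  obtain ⟨w, b, hb⟩ := exists_hilbertBasis ℝ H
  haveI : Countable w := ug_countable b.orthonormal
  obtain ⟨c, hc⟩ := exists_injective_nat w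
  have hS : ∀ n : ℕ, Orthonormal ℝ (fun i : w => e (Nat.pair n (c i))) := fun n =>
    he.comp _ (fun i j h => hc (Nat.pair_eq_pair.1 h).2)
  let S : ℕ → G →ₗᵢ[ℝ] H := fun n =>
    ((ugIso (hS n)).comp b.repr.toLinearIsometry).comp G.subtypeₗᵢ
  let T : ℕ → G →ₗᵢ[ℝ] H := fun n => Nat.casesOn n G.subtypeₗᵢ S
  have hge : ∀ (g : G) k, ⟪(g : H), e k⟫ = 0 := by
    intro g k
    rw [← ugIso_single he k]
    show ⟪(g : H), (ugIso he).toContinuousLinearMap _⟫ = 0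
    rw [← ContinuousLinearMap.adjoint_inner_left, ← hVs, hG, inner_zero_left]
  have hgS : ∀ (g : G) n (x : G), ⟪(g : H), S n x⟫ = 0 := fun g n x =>
    ugIso_zero (hS n) _ (innerSL ℝ (g : H)) fun i => hge g _
  have hSS : ∀ m n, m ≠ n → ∀ x y : G, ⟪S m x, S n y⟫ = 0 := fun m n hmn x y => by
    refine ugIso_zero (hS n) _ (innerSL ℝ (S m x)) fun i => ?_
    show ⟪S m x, e (Nat.pair n (c i))⟫ = 0
    rw [real_inner_comm]
    refine ugIso_zero (hS m) _ (innerSL ℝ (e (Nat.pair n (c i)))) fun j => ?_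
    exact he.2 (fun h => hmn (Nat.pair_eq_pair.1 h).1.symm)
  have hT : OrthogonalFamily ℝ (fun _ : ℕ => G) T := by
    intro m n hmn x y
    rcases m with _ | m <;> rcases n with _ | n
    · exact absurd rfl hmn
    · exact hgS x n y
    · rw [real_inner_comm]; exact hgS y m x
    · exact hSS m n (by omega) x y
  let a : G →L[ℝ] G := (A ∘L G.subtypeL).codRestrict G (fun g => by
    show Vs (A g) = 0
    rw [h2, hG])
  let a' : G →L[ℝ] G := (B ∘L G.subtypeL).codRestrict G (fun g => by
    show Vs (B g) = 0
    rw [h2', hG])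
  let qs : H →L[ℝ] G := (1 - (ugIso he).toContinuousLinearMap ∘L Vs).codRestrict G (fun g => by
    show Vs (g - ugIso he (Vs g)) = 0
    rw [map_sub, hVV, sub_self])
  have hq : qs = (T 0).toContinuousLinearMap.adjoint := by
    rw [ContinuousLinearMap.eq_adjoint_iff]
    intro h g
    show ⟪h - (ugIso he).toContinuousLinearMap (Vs h), (g : H)⟫ = ⟪h, (g : H)⟫
    rw [inner_sub_left, ← ContinuousLinearMap.adjoint_inner_right, ← hVs, hG, inner_zero_right,
      sub_zero]
  have := ug_swindle hmul hN hT a a' (fun x => Subtype.ext (hAB x)) (fun x => Subtype.ext (hBA x))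
  rw [← hq] at this
  convert! this using 1
  ext x
  show A x = x + (A (x - ugIso he (Vs x)) - (x - ugIso he (Vs x)))
  rw [map_sub, h1]
  abel

theorem ug_main [TopologicalSpace.SeparableSpace H] (hH : ¬ FiniteDimensional ℝ H)
    {P : (H →L[ℝ] H) → Prop} (hmul : ∀ A B, P A → P B → P (A * B))
    (hN : ∀ N : H →L[ℝ] H, N * N = 0 → P (1 + N))
    (A B : H →L[ℝ] H) (hBA : ∀ x, B (A x) = x) (hAB : ∀ x, A (B x) = x) : P A := by
  obtain ⟨e, f, he, hf, hfe, hfA⟩ := ug_exists_seq hH A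
  have hef : ∀ i j, ⟪e i, f j⟫ = 0 := fun i j => by rw [real_inner_comm]; exact hfe j i
  refine ug_move hmul hN A B hBA hAB (ugIso he).toContinuousLinearMap
    (ugIso hf).toContinuousLinearMap _ _ (ug_adj_self _) (ug_adj_self _)
    (ugIso_adj_zero he hf A hfA) fun A₁ B₁ hBA₁ hAB₁ hA₁ => ?_
  -- second move: from `f` to `e`; we use `A₁ V = W`
  have hz : ∀ x, (ugIso he).toContinuousLinearMap.adjoint (A₁ (ugIso he x)) = 0 := fun x => by
    have := hA₁ x
    simp only [LinearIsometry.coe_toContinuousLinearMap] at this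
    rw [this]
    exact ugIso_adj_zero hf he (ContinuousLinearMap.id ℝ H) hef x
  refine ug_move hmul hN A₁ B₁ hBA₁ hAB₁ (ugIso he).toContinuousLinearMap
    (ugIso he).toContinuousLinearMap _ _ (ug_adj_self _) (ug_adj_self _)
    hz fun A₂ B₂ hBA₂ hAB₂ hA₂ => ?_
  exact ug_diag hmul hN A₂ B₂ hBA₂ hAB₂ (ugIso he).toContinuousLinearMap _ (ug_adj_self _) hA₂
    fun A₃ B₃ hBA₃ hAB₃ h1 h2 => ug_block hmul hN he A₃ B₃ hBA₃ hAB₃ h1 h2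
end final


open RealInnerProductSpace

/-- Lemma 3 of the paper: on an infinite dimensional separable real
Hilbert space, any invertible bounded operator `A₀` can be realized by a smooth
diffeomorphism of `H` supported in the ball of radius `r₁`, which is linear equal to `A₀`
on a small ball of radius `r₀ < r₁`. -/
theorem linear_map_realized_by_compactly_supported_diffeo
    {H : Type*} [NormedAddCommGroup H] [InnerProductSpace ℝ H] [CompleteSpace H]
    [TopologicalSpace.SeparableSpace H] (hH : ¬ FiniteDimensional ℝ H)
    (A₀ : H ≃L[ℝ] H) (r₁ : ℝ) (hr₁ : 0 < r₁) :
    ∃ (r₀ : ℝ) (φ φinv : H → H), 0 < r₀ ∧ r₀ < r₁ ∧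
      ContDiff ℝ (⊤ : ℕ∞) φ ∧ ContDiff ℝ (⊤ : ℕ∞) φinv ∧
      Function.LeftInverse φinv φ ∧ Function.RightInverse φinv φ ∧
      (∀ u : H, r₁ ≤ ‖u‖ → φ u = u) ∧
      (∀ u : H, ‖u‖ ≤ r₀ → φ u = A₀ u) := by
  exact ug_main hH (P := UGGood r₁) (fun A B hA hB => UGGood.mul A B hA hB)
    (fun N hN => UGGood.unip hr₁ N hN) (A₀ : H →L[ℝ] H) (A₀.symm : H →L[ℝ] H)
    (fun x => by simp) (fun x => by simp)
end

section
/- Let H be an infinite-dimensional separable real Hilbert space, let A₀ : H → H be a bounded invertible linear operator, and let r₁ > 0. Then there exists a smooth map A : ℝ → GL(H) (smooth as a map into the space of bounded operators, with each A(t) invertible) such that A(t) = A₀ for all t ≤ r₁/2 and A(t) = I for all t ≥ r₁, where I is the identity operator. -/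
open scoped ENNReal lp

noncomputable section
namespace Kuiper

/-- shear group -/
def G (X : Type*) [NormedAddCommGroup X] [NormedSpace ℝ X] : Subgroup (X ≃L[ℝ] X) :=
  Subgroup.closure {u | ∀ x, u (u x - x) = u x - x}

variable {X Y Z : Type*} [NormedAddCommGroup X] [NormedSpace ℝ X]
  [NormedAddCommGroup Y] [NormedSpace ℝ Y] [NormedAddCommGroup Z] [NormedSpace ℝ Z]

@[simp] lemma one_ap (x : X) : (1 : X ≃L[ℝ] X) x = x := rfl
@[simp] lemma mul_ap (u v : X ≃L[ℝ] X) (x : X) : (u * v) x = u (v x) := rfl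

def conj (e : X ≃L[ℝ] Y) : (X ≃L[ℝ] X) →* (Y ≃L[ℝ] Y) where
  toFun u := (e.symm.trans u).trans e
  map_one' := by ext y; simp
  map_mul' u v := by ext y; simp

@[simp] lemma conj_apply (e : X ≃L[ℝ] Y) (u : X ≃L[ℝ] X) (y : Y) :
    conj e u y = e (u (e.symm y)) := rfl

lemma conj_mem (e : X ≃L[ℝ] Y) {u : X ≃L[ℝ] X} (hu : u ∈ G X) : conj e u ∈ G Y := by
  have : G X ≤ (G Y).comap (conj e) := by
    rw [G, Subgroup.closure_le]
    intro v hv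
    apply Subgroup.subset_closure
    intro y
    have := hv (e.symm y)
    apply e.symm.injective
    simpa using this
  exact this hu

lemma mem_of_conj (e : X ≃L[ℝ] Y) {u : X ≃L[ℝ] X} (hu : conj e u ∈ G Y) : u ∈ G X := by
  have := conj_mem e.symm hu
  convert this using 1
  ext x; simp

def sndHom (Y X : Type*) [NormedAddCommGroup X] [NormedSpace ℝ X]
    [NormedAddCommGroup Y] [NormedSpace ℝ Y] : (X ≃L[ℝ] X) →* ((Y × X) ≃L[ℝ] (Y × X)) where
  toFun u := (ContinuousLinearEquiv.refl ℝ Y).prodCongr u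
  map_one' := by ext y <;> simp
  map_mul' u v := by ext y <;> simp

lemma snd_mem {u : X ≃L[ℝ] X} (hu : u ∈ G X) :
    (ContinuousLinearEquiv.refl ℝ Y).prodCongr u ∈ G (Y × X) := by
  have : G X ≤ (G (Y × X)).comap (sndHom Y X) := by
    rw [G, Subgroup.closure_le]
    intro v hv
    apply Subgroup.subset_closure
    rintro ⟨y, x⟩
    have := hv x
    simpa [sndHom] using this
  exact this hu

/-- the shear `1 + N`. -/
def shear (N : X →L[ℝ] X) (hN : ∀ x, N (N x) = 0) : X ≃L[ℝ] X :=
  ContinuousLinearEquiv.equivOfInverse (.id ℝ X + N) (.id ℝ X - N)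
    (fun x => by simp [hN]) (fun x => by simp [hN])

@[simp] lemma shear_apply (N : X →L[ℝ] X) (hN) (x : X) : shear N hN x = x + N x := rfl

lemma shear_mem (N : X →L[ℝ] X) (hN) : shear N hN ∈ G X := by
  apply Subgroup.subset_closure
  intro x
  simp [hN]

def up (T : Y →L[ℝ] X) : (X × Y) ≃L[ℝ] (X × Y) :=
  shear ((ContinuousLinearMap.inl ℝ X Y) ∘L T ∘L ContinuousLinearMap.snd ℝ X Y) (by simp)
def lo (T : X →L[ℝ] Y) : (X × Y) ≃L[ℝ] (X × Y) :=
  shear ((ContinuousLinearMap.inr ℝ X Y) ∘L T ∘L ContinuousLinearMap.fst ℝ X Y) (by simp)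
lemma up_mem (T : Y →L[ℝ] X) : up T ∈ G (X × Y) := shear_mem _ _
lemma lo_mem (T : X →L[ℝ] Y) : lo T ∈ G (X × Y) := shear_mem _ _
@[simp] lemma up_apply (T : Y →L[ℝ] X) (p) : up T p = (p.1 + T p.2, p.2) := by
  ext <;> simp [up]
@[simp] lemma lo_apply (T : X →L[ℝ] Y) (p) : lo T p = (p.1, p.2 + T p.1) := by
  ext <;> simp [lo]

lemma whitehead (a : X ≃L[ℝ] X) : a.prodCongr a.symm ∈ G (X × X) := by
  have : a.prodCongr a.symm =
      up (a : X →L[ℝ] X) * lo (-(a.symm : X →L[ℝ] X)) * up (a : X →L[ℝ] X) *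
      (up (-.id ℝ X) * lo (.id ℝ X) * up (-.id ℝ X)) := by
    apply ContinuousLinearEquiv.ext
    funext p
    obtain ⟨x, y⟩ := p
    simp
  rw [this]
  exact mul_mem (mul_mem (mul_mem (up_mem _) (lo_mem _)) (up_mem _))
    (mul_mem (mul_mem (up_mem _) (lo_mem _)) (up_mem _))

/-- smooth path statement -/
lemma path {u : X ≃L[ℝ] X} (hu : u ∈ G X) : ∃ A : ℝ → (X →L[ℝ] X),
    ContDiff ℝ (⊤ : ℕ∞) A ∧ (∀ t, ∃ B : X ≃L[ℝ] X, A t = (B : X →L[ℝ] X)) ∧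
    (∀ t ≤ 0, A t = (u : X →L[ℝ] X)) ∧ (∀ t, 1 ≤ t → A t = .id ℝ X) := by
  have key : ∀ N : X →L[ℝ] X, (∀ x, N (N x) = 0) → ∃ A : ℝ → (X →L[ℝ] X),
    ContDiff ℝ (⊤ : ℕ∞) A ∧ (∀ t, ∃ B : X ≃L[ℝ] X, A t = (B : X →L[ℝ] X)) ∧
    (∀ t ≤ 0, A t = .id ℝ X + N) ∧ (∀ t, 1 ≤ t → A t = .id ℝ X) := by
    intro N hN
    refine ⟨fun t => .id ℝ X + Real.smoothTransition (1 - t) • N, ?_, ?_, ?_, ?_⟩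
    · have := (Real.smoothTransition.contDiff (n := ⊤)).comp
        ((contDiff_const (c := (1:ℝ))).sub (contDiff_id (𝕜 := ℝ) (E := ℝ)))
      exact contDiff_const.add (this.smul contDiff_const)
    · intro t
      exact ⟨shear (Real.smoothTransition (1 - t) • N) (by simp [hN]), by ext; simp⟩
    · intro t ht
      simp [Real.smoothTransition.one_of_one_le (show 1 ≤ 1 - t by linarith)]
    · intro t ht
      simp [Real.smoothTransition.zero_of_nonpos (show 1 - t ≤ 0 by linarith)]
  induction hu using Subgroup.closure_induction'' with
  | mem v hv =>
    obtain ⟨A, h1, h2, h3, h4⟩ := key ((v : X →L[ℝ] X) - .id ℝ X) (fun x => by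
      have := hv x
      simp only [map_sub] at this
      simp [this])
    exact ⟨A, h1, h2, fun t ht => by rw [h3 t ht]; abel, h4⟩
  | inv_mem v hv =>
    obtain ⟨A, h1, h2, h3, h4⟩ := key (-((v : X →L[ℝ] X) - .id ℝ X)) (fun x => by
      have := hv x
      simp only [map_sub] at this
      rw [sub_eq_iff_eq_add] at this
      simp [this])
    refine ⟨A, h1, h2, fun t ht => ?_, h4⟩
    rw [h3 t ht]
    ext x
    apply v.injective
    have := hv x
    have e : v (v⁻¹ x) = x := v.apply_symm_apply x
    simp only [map_sub] at this
    simp [e]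
    rw [sub_eq_iff_eq_add] at this
    rw [this]; abel
  | one => exact ⟨fun _ => .id ℝ X, contDiff_const, fun _ => ⟨1, rfl⟩, fun _ _ => rfl, fun _ _ => rfl⟩
  | mul x y hx hy ihx ihy =>
    obtain ⟨A, h1, h2, h3, h4⟩ := ihx
    obtain ⟨B, k1, k2, k3, k4⟩ := ihy
    refine ⟨fun t => (A t).comp (B t), h1.clm_comp k1, ?_, ?_, ?_⟩
    · intro t
      obtain ⟨a, ha⟩ := h2 t
      obtain ⟨b, hb⟩ := k2 t
      exact ⟨a * b, by simp only [ha, hb]; rfl⟩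
    · intro t ht
      simp only [h3 t ht, k3 t ht]; rfl
    · intro t ht
      simp only [h4 t ht, k4 t ht]; rfl

/-! ### ℓ² swindle -/

abbrev NN (X : Type*) [NormedAddCommGroup X] := lp (fun _ : ℕ => X) 2

def mapL (T : X →L[ℝ] X) : NN X →L[ℝ] NN X :=
  lp.mapCLM (𝕜 := ℝ) 2 (fun _ : ℕ => T) (K := ‖T‖) (norm_nonneg _) (fun _ => le_rfl)

lemma mapL_apply (T : X →L[ℝ] X) (f : NN X) (i : ℕ) : mapL T f i = T (f i) := rfl

def diag (D : X ≃L[ℝ] X) : NN X ≃L[ℝ] NN X :=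
  ContinuousLinearEquiv.equivOfInverse (mapL D) (mapL D.symm)
    (fun f => by ext i; simp [mapL_apply]) (fun f => by ext i; simp [mapL_apply])

lemma diag_apply (D : X ≃L[ℝ] X) (f : NN X) (i : ℕ) : diag D f i = D (f i) := rfl
lemma diag_symm_apply (D : X ≃L[ℝ] X) (f : NN X) (i : ℕ) : (diag D).symm f i = D.symm (f i) := rfl

def tailL : NN X →L[ℝ] NN X :=
  LinearMap.mkContinuous
    { toFun := fun f => ⟨fun i => f (i + 1), by
        apply memℓp_gen
        exact (summable_nat_add_iff 1).2 ((lp.memℓp f).summable (by norm_num))⟩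
      map_add' := fun f g => by ext i; rfl
      map_smul' := fun c f => by ext i; rfl } 1 (fun f => by
    rw [one_mul]
    apply lp.norm_le_of_forall_sum_le (by norm_num) (norm_nonneg _)
    intro s
    have := lp.sum_rpow_le_norm_rpow (p := 2) (by norm_num) f (s.map (addRightEmbedding 1))
    simpa using this)

lemma tailL_apply (f : NN X) (i : ℕ) : tailL f i = f (i + 1) := rfl

def evalL (i : ℕ) : NN X →L[ℝ] X :=
  LinearMap.mkContinuous
    { toFun := fun f => f i
      map_add' := fun f g => rfl
      map_smul' := fun c f => rfl } 1 (fun f => by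
    rw [one_mul]; exact lp.norm_apply_le_norm (by norm_num) f i)

lemma evalL_apply (f : NN X) (i : ℕ) : evalL i f = f i := rfl

def consE [CompleteSpace X] : NN X ≃L[ℝ] (X × NN X) :=
  ContinuousLinearEquiv.ofBijective ((evalL 0).prod tailL)
    (by
      rw [LinearMap.ker_eq_bot']
      intro f hf
      have h := Prod.ext_iff.1 hf
      ext i
      cases i with
      | zero => exact h.1
      | succ i => exact congrArg (fun g : NN X => g i) h.2)
    (by
      rw [LinearMap.range_eq_top]
      rintro ⟨x, f⟩
      refine ⟨⟨fun i => Nat.casesOn i x (fun j => f j), ?_⟩, ?_⟩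
      · apply memℓp_gen
        refine (summable_nat_add_iff 1).1 ?_
        exact (lp.memℓp f).summable (by norm_num)
      · rfl)

lemma consE_apply [CompleteSpace X] (f : NN X) : consE f = (f 0, tailL f) := rfl

lemma swindle [CompleteSpace X] (D : X ≃L[ℝ] X) :
    D.prodCongr (ContinuousLinearEquiv.refl ℝ (NN X × NN X)) ∈ G (X × (NN X × NN X)) := by
  let e : (NN X × NN X) ≃L[ℝ] (X × (NN X × NN X)) :=
    (consE.prodCongr (.refl ℝ (NN X))).trans (ContinuousLinearEquiv.prodAssoc ℝ X (NN X) (NN X))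
  have h1 : conj e ((diag D).prodCongr (diag D).symm) ∈ G (X × (NN X × NN X)) :=
    conj_mem e (whitehead (diag D))
  have h2 : (ContinuousLinearEquiv.refl ℝ X).prodCongr
      ((diag D).symm.prodCongr (diag D)) ∈ G (X × (NN X × NN X)) :=
    snd_mem (whitehead (diag D).symm)
  have h := mul_mem h1 h2
  convert h using 1
  have hc : conj e ((diag D).prodCongr (diag D).symm) =
      D.prodCongr ((diag D).prodCongr (diag D).symm) := by
    apply ContinuousLinearEquiv.ext
    funext p
    obtain ⟨⟨f, g⟩, rfl⟩ := e.surjective p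
    simp only [conj_apply, ContinuousLinearEquiv.symm_apply_apply]
    rfl
  rw [hc]
  apply ContinuousLinearEquiv.ext
  funext p
  obtain ⟨x, f, g⟩ := p
  simp

end Kuiper

namespace Kuiper

lemma exists_equiv_l2 (H : Type*) [NormedAddCommGroup H] [InnerProductSpace ℝ H] [CompleteSpace H]
    [TopologicalSpace.SeparableSpace H] (hH : ¬ FiniteDimensional ℝ H) :
    Nonempty (H ≃L[ℝ] ℓ²(ℕ, ℝ)) := by
  obtain ⟨w, b, hb⟩ := exists_hilbertBasis ℝ H
  have hc : Countable w := by
    have hd : (Set.univ : Set w).PairwiseDisjoint (fun i : w => Metric.ball (b i) (1/2)) := by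
      intro i _ j _ hij
      apply Metric.ball_disjoint_ball
      have h0 : inner ℝ (b i) (b j) = 0 := b.orthonormal.2 hij
      have h1 := b.orthonormal.1 i
      have h2 := b.orthonormal.1 j
      have h3 := norm_sub_sq_real (b i) (b j)
      rw [h0, h1, h2] at h3
      rw [dist_eq_norm]
      nlinarith [norm_nonneg (b i - b j)]
    have := hd.countable_of_isOpen (fun i _ => Metric.isOpen_ball)
      (fun i _ => ⟨b i, Metric.mem_ball_self (by norm_num)⟩)
    exact Set.countable_univ_iff.1 this
  have hi : Infinite w := by
    by_contra h
    rw [not_infinite_iff_finite] at h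
    have := Fintype.ofFinite w
    exact hH (b.toOrthonormalBasis.toBasis.finiteDimensional_of_finite)
  obtain ⟨e⟩ : Nonempty (ℕ ≃ w) := by
    haveI := hc
    haveI := hi
    obtain ⟨d⟩ := nonempty_denumerable w
    exact ⟨(Denumerable.eqv w).symm⟩
  have ho : Orthonormal ℝ (b ∘ e) := b.orthonormal.comp e e.injective
  let b' : HilbertBasis ℕ ℝ H := HilbertBasis.mk ho (by
    rw [Set.range_comp, e.range_eq_univ, Set.image_univ, b.dense_span])
  exact ⟨b'.repr.toContinuousLinearEquiv⟩

section
variable {M : Type*} [NormedAddCommGroup M] [InnerProductSpace ℝ M] [CompleteSpace M]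

lemma sep_NN [TopologicalSpace.SeparableSpace M] : TopologicalSpace.SeparableSpace (NN M) := by
  let v : ℕ × ℕ → NN M := fun p => lp.single 2 p.1 (TopologicalSpace.denseSeq M p.2)
  have hbot : (Submodule.span ℝ (Set.range v))ᗮ = ⊥ := by
    rw [Submodule.eq_bot_iff]
    intro x hx
    rw [Submodule.mem_orthogonal] at hx
    ext i
    have h1 : ∀ j, inner ℝ (TopologicalSpace.denseSeq M j) (x i) = 0 := by
      intro j
      have := hx (v (i, j)) (Submodule.subset_span ⟨_, rfl⟩)
      simpa [v, lp.inner_single_left] using this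
    have h2 : ∀ y : M, inner ℝ y (x i) = 0 := by
      have hc : Continuous fun y : M => inner ℝ y (x i) := by fun_prop
      have := DenseRange.equalizer (TopologicalSpace.denseRange_denseSeq M) hc
        (continuous_const (y := (0:ℝ))) (by funext j; exact h1 j)
      exact fun y => congrFun this y
    simpa using h2 (x i)
  rw [← Submodule.topologicalClosure_eq_top_iff] at hbot
  have hs : TopologicalSpace.IsSeparable (closure (Submodule.span ℝ (Set.range v) : Set (NN M))) :=
    ((Set.countable_range v).isSeparable.span (R := ℝ)).closure
  rw [← Submodule.topologicalClosure_coe, hbot] at hs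
  exact TopologicalSpace.isSeparable_univ_iff.1 hs

lemma infdim_NN (hM : ¬ FiniteDimensional ℝ M) : ¬ FiniteDimensional ℝ (NN M) := by
  intro h
  apply hM
  apply FiniteDimensional.of_injective (lp.lsingle (𝕜 := ℝ) (E := fun _ : ℕ => M) 2 0)
  intro x y hxy
  have := congrArg (fun f : NN M => f 0) hxy
  simpa using this

lemma prod_equiv [TopologicalSpace.SeparableSpace M] (hM : ¬ FiniteDimensional ℝ M) :
    Nonempty ((NN M × NN M) ≃L[ℝ] ℓ²(ℕ, ℝ)) := by
  haveI := sep_NN (M := M)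
  let e := WithLp.prodContinuousLinearEquiv 2 ℝ (NN M) (NN M)
  haveI : TopologicalSpace.SeparableSpace (WithLp 2 (NN M × NN M)) :=
    e.symm.surjective.denseRange.separableSpace e.symm.continuous
  obtain ⟨f⟩ := exists_equiv_l2 (WithLp 2 (NN M × NN M)) (by
    intro h
    apply infdim_NN hM
    apply FiniteDimensional.of_injective
      ((e.symm : (NN M × NN M) →ₗ[ℝ] WithLp 2 (NN M × NN M)) ∘ₗ LinearMap.inl ℝ (NN M) (NN M))
    intro x y hxy
    have := e.symm.injective hxy
    exact (Prod.ext_iff.1 this).1)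
  exact ⟨e.symm.trans f⟩

lemma swindle' [TopologicalSpace.SeparableSpace M] (hM : ¬ FiniteDimensional ℝ M)
    (D : M ≃L[ℝ] M) :
    D.prodCongr (ContinuousLinearEquiv.refl ℝ ℓ²(ℕ, ℝ)) ∈ G (M × ℓ²(ℕ, ℝ)) := by
  obtain ⟨f⟩ := prod_equiv hM
  have := conj_mem ((ContinuousLinearEquiv.refl ℝ M).prodCongr f) (swindle D)
  convert this using 1
  apply ContinuousLinearEquiv.ext
  funext p
  obtain ⟨x, y⟩ := p
  simp
end

section
variable {H : Type*} [NormedAddCommGroup H] [InnerProductSpace ℝ H] [CompleteSpace H]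

lemma exists_seq (hH : ¬ FiniteDimensional ℝ H) (A : H ≃L[ℝ] H) :
    ∃ v : ℕ → H, (∀ n, ‖v n‖ = 1) ∧ (∀ m n, m ≠ n → inner ℝ (v m) (v n) = 0 ∧
      inner ℝ (v m) (A (v n)) = 0 ∧ inner ℝ (v m) (A.symm (v n)) = 0) := by
  let r : H → H → Prop := fun x y => inner ℝ x y = 0 ∧ inner ℝ (A x) y = 0 ∧
    inner ℝ (A.symm x) y = 0 ∧
    inner ℝ ((A : H →L[ℝ] H).adjoint x) y = 0 ∧ inner ℝ ((A.symm : H →L[ℝ] H).adjoint x) y = 0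
  obtain ⟨v, h1, h2⟩ := exists_seq_of_forall_finset_exists (fun x : H => ‖x‖ = 1) r (by
    intro s _
    let S : Set H := (s : Set H) ∪ A '' s ∪ A.symm '' s ∪ (A : H →L[ℝ] H).adjoint '' s ∪
      (A.symm : H →L[ℝ] H).adjoint '' s
    have hS : S.Finite := by
      refine Set.Finite.union (Set.Finite.union (Set.Finite.union (Set.Finite.union ?_ ?_) ?_) ?_) ?_
      · exact s.finite_toSet
      all_goals exact s.finite_toSet.image _
    haveI : FiniteDimensional ℝ (Submodule.span ℝ S) := FiniteDimensional.span_of_finite ℝ hS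
    have hne : (Submodule.span ℝ S)ᗮ ≠ ⊥ := by
      intro hb
      rw [Submodule.orthogonal_eq_bot_iff] at hb
      apply hH
      have : FiniteDimensional ℝ (⊤ : Submodule ℝ H) := hb ▸ this
      exact Module.finite_def.2 (Module.Finite.iff_fg.1 this)
    obtain ⟨y, hy, hy0⟩ := Submodule.exists_mem_ne_zero_of_ne_bot hne
    have hz : ∀ x ∈ S, inner ℝ x ((‖y‖⁻¹ : ℝ) • y) = 0 := by
      intro x hx
      rw [inner_smul_right, (Submodule.mem_orthogonal _ _).1 hy x (Submodule.subset_span hx), mul_zero]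
    refine ⟨(‖y‖⁻¹ : ℝ) • y, ?_, ?_⟩
    · rw [norm_smul, norm_inv, norm_norm, inv_mul_cancel₀ (norm_ne_zero_iff.2 hy0)]
    · intro x hx
      have hx' : x ∈ (s : Set H) := hx
      refine ⟨hz _ ?_, hz _ ?_, hz _ ?_, hz _ ?_, hz _ ?_⟩
      · exact .inl (.inl (.inl (.inl hx)))
      · exact .inl (.inl (.inl (.inr ⟨x, hx, rfl⟩)))
      · exact .inl (.inl (.inr ⟨x, hx, rfl⟩))
      · exact .inl (.inr ⟨x, hx, rfl⟩)
      · exact .inr ⟨x, hx, rfl⟩)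
  refine ⟨v, h1, fun m n hmn => ?_⟩
  rcases lt_or_gt_of_ne hmn with h | h
  · obtain ⟨a1, a2, a3, a4, a5⟩ := h2 m n h
    rw [ContinuousLinearMap.adjoint_inner_left] at a4 a5
    exact ⟨a1, a4, a5⟩
  · obtain ⟨a1, a2, a3, a4, a5⟩ := h2 n m h
    rw [real_inner_comm] at a1 a2 a3
    exact ⟨a1, a2, a3⟩

lemma exists_iso {v : ℕ → H} (hv : Orthonormal ℝ v) : ∃ E : ℓ²(ℕ, ℝ) →ₗᵢ[ℝ] H,
    ∀ f, HasSum (fun i => (f i : ℝ) • v i) (E f) := by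
  refine ⟨hv.orthogonalFamily.linearIsometry, fun f => ?_⟩
  simpa using hv.orthogonalFamily.hasSum_linearIsometry f

lemma inner_zero {v w : ℕ → H} {E F : ℓ²(ℕ, ℝ) →ₗᵢ[ℝ] H}
    (hE : ∀ f, HasSum (fun i => (f i : ℝ) • v i) (E f))
    (hF : ∀ f, HasSum (fun i => (f i : ℝ) • w i) (F f)) (B : H →L[ℝ] H)
    (h : ∀ i j, inner ℝ (v i) (B (w j)) = 0) (f g) : inner ℝ (E f) (B (F g)) = 0 := by
  have h1 : ∀ i, inner ℝ (v i) (B (F g)) = 0 := by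
    intro i
    have := (hF g).mapL ((innerSL ℝ (v i)) ∘L B)
    simp [h, inner_smul_right] at this
    exact (this.unique hasSum_zero)
  have := (hE f).mapL (innerSL ℝ (B (F g)))
  simp [inner_smul_right, real_inner_comm, h1] at this
  exact (this.unique hasSum_zero)

/-- An operator fixing the range of an isometry with infinite-codimensional range. -/
lemma mem_of_fix [TopologicalSpace.SeparableSpace H] (E : ℓ²(ℕ, ℝ) →L[ℝ] H)
    (E' : H →L[ℝ] ℓ²(ℕ, ℝ)) (hE : ∀ k, E' (E k) = k) (A : H ≃L[ℝ] H) (hA : ∀ k, A (E k) = E k)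
    (hM : ¬ FiniteDimensional ℝ (LinearMap.ker (E' : H →ₗ[ℝ] ℓ²(ℕ, ℝ)))) : A ∈ G H := by
  let M := LinearMap.ker (E' : H →ₗ[ℝ] ℓ²(ℕ, ℝ))
  have hMc : IsClosed (M : Set H) := ContinuousLinearMap.isClosed_ker E'
  haveI : CompleteSpace M := hMc.completeSpace_coe
  have hA' : ∀ k, A.symm (E k) = E k := fun k => by rw [A.symm_apply_eq, hA]
  have hm : ∀ m : M, E' m = 0 := fun m => m.2
  let Q : H →L[ℝ] M := (ContinuousLinearMap.id ℝ H - E ∘L E').codRestrict M (fun x => by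
    simp [M, hE])
  have hQ : ∀ x, (Q x : H) = x - E (E' x) := fun x => rfl
  let e : H ≃L[ℝ] (M × ℓ²(ℕ, ℝ)) := ContinuousLinearEquiv.equivOfInverse
    (Q.prod E') (M.subtypeL.coprod E)
    (fun x => by simp [hQ])
    (fun p => by
      obtain ⟨m, k⟩ := p
      ext1
      · ext1
        simp [hQ, hE, hm]
      · simp [hE, hm])
  have he : ∀ x, e x = (Q x, E' x) := fun _ => rfl
  have hes : ∀ p, e.symm p = (p.1 : H) + E p.2 := fun _ => rfl
  let D : M ≃L[ℝ] M := ContinuousLinearEquiv.equivOfInverse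
    (Q ∘L (A : H →L[ℝ] H) ∘L M.subtypeL) (Q ∘L (A.symm : H →L[ℝ] H) ∘L M.subtypeL)
    (fun m => by ext1; simp [hQ, hA', hE, hm]) (fun m => by ext1; simp [hQ, hA, hE, hm])
  have hD : ∀ m, D m = Q (A m) := fun _ => rfl
  apply mem_of_conj e
  have h := mul_mem (lo_mem (E' ∘L (A : H →L[ℝ] H) ∘L M.subtypeL ∘L (D.symm : M →L[ℝ] M)))
    (swindle' hM D)
  convert h using 1
  apply ContinuousLinearEquiv.ext
  funext p
  obtain ⟨m, k⟩ := p
  simp only [conj_apply, hes, he, mul_ap, ContinuousLinearEquiv.prodCongr_apply, lo_apply]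
  ext1
  · ext1
    simp [hQ, hD, hA, hE]
  · simp [hA, hE, add_comm]

lemma all_mem [TopologicalSpace.SeparableSpace H] (hH : ¬ FiniteDimensional ℝ H)
    (A : H ≃L[ℝ] H) : A ∈ G H := by
  obtain ⟨v, hv1, hv2⟩ := exists_seq hH A
  have ho : Orthonormal ℝ v := ⟨hv1, fun i j hij => (hv2 i j hij).1⟩
  obtain ⟨E, hE⟩ := exists_iso (ho.comp (fun n : ℕ => 2 * n) (fun a b h => by simpa using h))
  obtain ⟨F, hF⟩ := exists_iso (ho.comp (fun n : ℕ => 2 * n + 1) (fun a b h => by simpa using h))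
  let E1 : ℓ²(ℕ, ℝ) →L[ℝ] H := E.toContinuousLinearMap
  let G1 : ℓ²(ℕ, ℝ) →L[ℝ] H := F.toContinuousLinearMap
  let E' := E1.adjoint
  let G' := G1.adjoint
  have ne1 : ∀ i j : ℕ, 2 * i ≠ 2 * j + 1 := fun i j => by omega
  have hEE : ∀ k, E' (E1 k) = k := fun k => by
    refine ext_inner_left ℝ fun w => ?_
    rw [ContinuousLinearMap.adjoint_inner_right]
    exact E.inner_map_map _ _
  have hGG : ∀ k, G' (G1 k) = k := fun k => by
    refine ext_inner_left ℝ fun w => ?_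
    rw [ContinuousLinearMap.adjoint_inner_right]
    exact F.inner_map_map _ _
  have hEG : ∀ k, E' (G1 k) = 0 := fun k => by
    refine ext_inner_left ℝ fun w => ?_
    rw [ContinuousLinearMap.adjoint_inner_right, inner_zero_right]
    exact inner_zero hE hF (.id ℝ H) (fun i j => (hv2 _ _ (ne1 i j)).1) w k
  have hGE : ∀ k, G' (E1 k) = 0 := fun k => by
    refine ext_inner_left ℝ fun w => ?_
    rw [ContinuousLinearMap.adjoint_inner_right, inner_zero_right]
    exact inner_zero hF hE (.id ℝ H) (fun i j => (hv2 _ _ (ne1 j i).symm).1) w k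
  have hGA : ∀ k, G' (A (E1 k)) = 0 := fun k => by
    refine ext_inner_left ℝ fun w => ?_
    rw [ContinuousLinearMap.adjoint_inner_right, inner_zero_right]
    exact inner_zero hF hE (A : H →L[ℝ] H) (fun i j => (hv2 _ _ (ne1 j i).symm).2.1) w k
  have hEA : ∀ k, E' (A.symm (G1 k)) = 0 := fun k => by
    refine ext_inner_left ℝ fun w => ?_
    rw [ContinuousLinearMap.adjoint_inner_right, inner_zero_right]
    exact inner_zero hE hF (A.symm : H →L[ℝ] H) (fun i j => (hv2 _ _ (ne1 i j)).2.2) w k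
  let s1 := shear (G1 ∘L E' ∘L (A.symm : H →L[ℝ] H)) (fun x => by simp [hEA])
  let s2 := shear (-((A : H →L[ℝ] H) ∘L E1 ∘L G')) (fun x => by simp [hGA])
  let s3 := shear (E1 ∘L G') (fun x => by simp [hGE])
  let s4 := shear (-(G1 ∘L E')) (fun x => by simp [hEG])
  have hs : s4 * s3 * s2 * s1 ∈ G H :=
    mul_mem (mul_mem (mul_mem (shear_mem _ _) (shear_mem _ _)) (shear_mem _ _)) (shear_mem _ _)
  have hfix : (s4 * s3 * s2 * s1) * A ∈ G H := by
    apply mem_of_fix E1 E' hEE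
    · intro k
      simp [s1, s2, s3, s4, hEE, hGG, hEG, hGE, hGA]
    · intro hfd
      have : FiniteDimensional ℝ ℓ²(ℕ, ℝ) := by
        apply FiniteDimensional.of_injective ((G1 : ℓ²(ℕ, ℝ) →ₗ[ℝ] H).codRestrict
          (LinearMap.ker (E' : H →ₗ[ℝ] ℓ²(ℕ, ℝ))) (fun k => hEG k))
        intro x y hxy
        exact F.injective (congrArg Subtype.val hxy)
      obtain ⟨f⟩ := exists_equiv_l2 H hH
      exact hH (f.symm.toLinearEquiv.finiteDimensional)
  exact (Subgroup.mul_mem_cancel_left _ hs).1 hfix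

end
end Kuiper

end

/-- by Kuiper's theorem, `GL(H)` of an infinite dimensional separable real
Hilbert space is connected, so there is a smooth path of invertible bounded operators
joining a given `A₀` (for `t ≤ r₁/2`) to the identity (for `t ≥ r₁`). -/
theorem exists_smooth_path_of_invertibles_to_id
    {H : Type*} [NormedAddCommGroup H] [InnerProductSpace ℝ H] [CompleteSpace H]
    [TopologicalSpace.SeparableSpace H] (hH : ¬ FiniteDimensional ℝ H)
    (A₀ : H ≃L[ℝ] H) (r₁ : ℝ) (hr₁ : 0 < r₁) :
    ∃ A : ℝ → (H →L[ℝ] H), ContDiff ℝ (⊤ : ℕ∞) A ∧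
      (∀ t : ℝ, ∃ B : H ≃L[ℝ] H, A t = (B : H →L[ℝ] H)) ∧
      (∀ t : ℝ, t ≤ r₁ / 2 → A t = (A₀ : H →L[ℝ] H)) ∧
      (∀ t : ℝ, r₁ ≤ t → A t = ContinuousLinearMap.id ℝ H) := by
  obtain ⟨A, h1, h2, h3, h4⟩ := Kuiper.path (Kuiper.all_mem hH A₀)
  refine ⟨fun t => A (2 / r₁ * t - 1), ?_, fun t => h2 _, fun t ht => h3 _ ?_, fun t ht => h4 _ ?_⟩
  · exact h1.comp ((contDiff_const.mul contDiff_id).sub contDiff_const)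
  · have : 2 / r₁ * t ≤ 2 / r₁ * (r₁ / 2) := by gcongr
    have h' : 2 / r₁ * (r₁ / 2) = 1 := by field_simp
    linarith
  · have : 2 / r₁ * r₁ ≤ 2 / r₁ * t := by gcongr
    have h' : 2 / r₁ * r₁ = 2 := by field_simp
    linarith
end

section
/- Let H be a real Hilbert space, r₁ > 0, and let A : ℝ → GL(H) be a smooth map with A(t) = A(0) for t ≤ r₁/2 and A(t) = I for t ≥ r₁. Then there exist a number r₀ ∈ (0, r₁) and a smooth function μ : (0,+∞) → (0,+∞) such that μ(t) = t for all t ≤ r₀ and for all t ≥ r₁, and μ′(t) > ‖A(t)⁻¹ A′(t)‖ μ(t) for every t > 0. -/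
theorem aux_step : ∃ (S f : ℝ → ℝ) (M : ℝ), ContDiff ℝ (⊤ : ℕ∞) S ∧ Continuous f ∧
    (∀ x, HasDerivAt S (f x) x) ∧ (∀ x, 0 ≤ f x) ∧ (∀ x, 0 < x → x < 1 → 0 < f x) ∧
    (∀ x, x ≤ 0 → f x = 0) ∧ (∀ x, 1 ≤ x → f x = 0) ∧ (∀ x, x ≤ 0 → S x = 0) ∧
    (∀ x, 1 ≤ x → S x = 1) ∧ 0 < M ∧ (∀ x, f x ≤ M) := by
  set φ : ℝ → ℝ := fun x => expNegInvGlue x * expNegInvGlue (1 - x) with hφ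
  have hsm : ContDiff ℝ (⊤ : ℕ∞) φ :=
    expNegInvGlue.contDiff.mul (expNegInvGlue.contDiff.comp (contDiff_const.sub contDiff_id))
  have hc : Continuous φ := hsm.continuous
  have h0 : ∀ x, 0 ≤ φ x := fun x => mul_nonneg (expNegInvGlue.nonneg _) (expNegInvGlue.nonneg _)
  have hpos : ∀ x, 0 < x → x < 1 → 0 < φ x := fun x hx hx1 =>
    mul_pos (expNegInvGlue.pos_of_pos hx) (expNegInvGlue.pos_of_pos (by linarith))
  have hl : ∀ x, x ≤ 0 → φ x = 0 := fun x hx => by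
    simp [hφ, expNegInvGlue.zero_of_nonpos hx]
  have hr : ∀ x, 1 ≤ x → φ x = 0 := fun x hx => by
    simp [hφ, expNegInvGlue.zero_of_nonpos (show 1 - x ≤ 0 by linarith)]
  set c : ℝ := ∫ x in (0:ℝ)..1, φ x with hcdef
  have hcpos : 0 < c := by
    apply intervalIntegral.intervalIntegral_pos_of_pos_on (hc.intervalIntegrable _ _)
    · intro x hx
      exact hpos x hx.1 hx.2
    · norm_num
  obtain ⟨M, hM⟩ := (isCompact_Icc (a := (0:ℝ)) (b := 1)).bddAbove_image hc.continuousOn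
  have hMb : ∀ x, φ x ≤ |M| := by
    intro x
    by_cases h1 : x ≤ 0
    · rw [hl x h1]; positivity
    by_cases h2 : 1 ≤ x
    · rw [hr x h2]; positivity
    · exact (hM ⟨x, ⟨by linarith, by linarith⟩, rfl⟩).trans (le_abs_self M)
  have hder : ∀ x, HasDerivAt (fun x => (∫ y in (0:ℝ)..x, φ y) / c) (φ x / c) x := fun x =>
    (intervalIntegral.integral_hasDerivAt_right (hc.intervalIntegrable _ _)
      (hc.stronglyMeasurableAtFilter _ _) hc.continuousAt).div_const c
  refine ⟨fun x => (∫ y in (0:ℝ)..x, φ y) / c, fun x => φ x / c, (|M| + 1) / c, ?_, by fun_prop,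
    hder, fun x => div_nonneg (h0 x) hcpos.le, fun x h k => div_pos (hpos x h k) hcpos,
    fun x h => by simp [hl x h], fun x h => by simp [hr x h], ?_, ?_, by positivity, ?_⟩
  · rw [contDiff_infty_iff_deriv]
    refine ⟨fun x => (hder x).differentiableAt, ?_⟩
    rw [funext fun x => (hder x).deriv]
    exact hsm.div_const c
  · intro x hx
    have : ∫ y in (0:ℝ)..x, φ y = ∫ y in (0:ℝ)..x, (0:ℝ) := by
      apply intervalIntegral.integral_congr
      intro y hy
      rw [Set.uIcc_of_ge hx] at hy
      exact hl y hy.2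
    simp [this]
  · intro x hx
    have : ∫ y in (1:ℝ)..x, φ y = ∫ y in (1:ℝ)..x, (0:ℝ) := by
      apply intervalIntegral.integral_congr
      intro y hy
      rw [Set.uIcc_of_le hx] at hy
      exact hr y hy.1
    have h2 := intervalIntegral.integral_add_adjacent_intervals
      (hc.intervalIntegrable (μ := MeasureTheory.volume) 0 1)
      (hc.intervalIntegrable (μ := MeasureTheory.volume) 1 x)
    rw [this] at h2
    simp only [intervalIntegral.integral_zero, add_zero] at h2
    simp only [← h2]
    exact div_self hcpos.ne'
  · intro x
    have := hMb x
    exact div_le_div_of_nonneg_right (by linarith) hcpos.le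

theorem aux_mu (r₁ : ℝ) (hr₁ : 0 < r₁) (g : ℝ → ℝ) (hg : Continuous g)
    (hg0 : ∀ t, t ≤ r₁ / 2 → g t = 0) (hg1 : ∀ t, r₁ ≤ t → g t = 0) :
    ∃ (r₀ : ℝ) (μ : ℝ → ℝ), 0 < r₀ ∧ r₀ < r₁ ∧
      ContDiffOn ℝ (⊤ : ℕ∞) μ (Set.Ioi (0 : ℝ)) ∧
      (∀ t : ℝ, 0 < t → 0 < μ t) ∧
      (∀ t : ℝ, 0 < t → t ≤ r₀ → μ t = t) ∧
      (∀ t : ℝ, r₁ ≤ t → μ t = t) ∧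
      (∀ t : ℝ, 0 < t → g t * μ t < deriv μ t) := by
  obtain ⟨S, f, M, hS, hf, hd, hf0, hfp, hfl, hfr, hSl, hSr, hM, hfM⟩ := aux_step
  obtain ⟨a, ha⟩ : ∃ a, a = r₁ / 4 := ⟨_, rfl⟩
  have ha0 : 0 < a := by linarith
  obtain ⟨w, hw⟩ : ∃ w, w = r₁ - a := ⟨_, rfl⟩
  have hw0 : 0 < w := by linarith
  -- near r₁ the function g is small
  obtain ⟨s, hsr, hs⟩ : ∃ s, s < r₁ ∧ ∀ t, s < t → t * g t < 1 := by
    have hcont : Continuous fun t => t * g t := by fun_prop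
    have hev : ∀ᶠ t in nhds r₁, t * g t < 1 :=
      hcont.continuousAt.eventually_lt continuousAt_const (by simp [hg1 r₁ le_rfl])
    obtain ⟨ε, hε, hb⟩ := Metric.eventually_nhds_iff.1 hev
    refine ⟨r₁ - ε / 2, by linarith, fun t ht => ?_⟩
    by_cases h : r₁ ≤ t
    · simp [hg1 t h]
    · apply hb
      rw [Real.dist_eq, abs_lt]
      constructor <;> linarith
  -- a large constant
  obtain ⟨K, hK0, hK⟩ : ∃ K, 0 < K ∧ ∀ t, r₁ / 2 ≤ t → t ≤ s →
      g t ≤ K * (f ((t - a) / w) / w) := by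
    have hne : ∀ t ∈ Set.Icc (r₁ / 2) s, 0 < f ((t - a) / w) := by
      intro t ht
      apply hfp
      · apply div_pos _ hw0
        linarith [ht.1]
      · rw [div_lt_one hw0]
        linarith [ht.2]
    have hco : ContinuousOn (fun t => g t / (f ((t - a) / w) / w)) (Set.Icc (r₁ / 2) s) := by
      apply hg.continuousOn.div (by fun_prop)
      intro t ht
      exact (div_pos (hne t ht) hw0).ne'
    obtain ⟨C, hC⟩ := (isCompact_Icc (a := r₁ / 2) (b := s)).bddAbove_image hco
    refine ⟨|C| + 1, by positivity, fun t h1 h2 => ?_⟩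
    have h3 := hC ⟨t, ⟨h1, h2⟩, rfl⟩
    have h4 := div_pos (hne t ⟨h1, h2⟩) hw0
    rw [← div_le_iff₀ h4]
    simp only at h3
    linarith [le_abs_self C]
  obtain ⟨L, hL⟩ : ∃ L, L = K * M + 1 := ⟨_, rfl⟩
  have hKM : 0 < K * M := mul_pos hK0 hM
  have hL0 : 0 < L := by linarith
  obtain ⟨b, hb⟩ : ∃ b, b = Real.log a - L := ⟨_, rfl⟩
  have hr0a : Real.exp b < a := by
    rw [← Real.lt_log_iff_exp_lt ha0]
    linarith
  refine ⟨Real.exp b, fun t => t * Real.exp (K * (S ((t - a) / w) - S ((Real.log t - b) / L))),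
    Real.exp_pos _, by linarith, ?_, fun t ht => by positivity, ?_, ?_, ?_⟩
  · have hlog : ContDiffOn ℝ (⊤ : ℕ∞) Real.log (Set.Ioi 0) :=
      Real.contDiffOn_log.mono fun x hx => by
        simpa using (ne_of_gt hx)
    have h1 : ContDiffOn ℝ (⊤ : ℕ∞) (fun t => S ((Real.log t - b) / L)) (Set.Ioi 0) :=
      hS.comp_contDiffOn ((hlog.sub contDiffOn_const).div_const L)
    have h2 : ContDiffOn ℝ (⊤ : ℕ∞) (fun t => S ((t - a) / w)) (Set.Ioi 0) :=
      hS.comp_contDiffOn ((contDiffOn_id.sub contDiffOn_const).div_const w)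
    exact contDiffOn_id.mul (contDiffOn_const.mul (h2.sub h1)).exp
  · intro t ht h
    have h1 : S ((t - a) / w) = 0 :=
      hSl _ (div_nonpos_of_nonpos_of_nonneg (by linarith) hw0.le)
    have h2 : S ((Real.log t - b) / L) = 0 := by
      apply hSl _ (div_nonpos_of_nonpos_of_nonneg _ hL0.le)
      have := (Real.log_le_iff_le_exp ht).2 h
      linarith
    simp [h1, h2]
  · intro t h
    have h1 : S ((t - a) / w) = 1 := by
      apply hSr
      rw [one_le_div hw0]
      linarith
    have h2 : S ((Real.log t - b) / L) = 1 := by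
      apply hSr
      rw [one_le_div hL0]
      have := Real.log_le_log ha0 (show a ≤ t by linarith)
      linarith
    simp [h1, h2]
  · intro t ht
    have hd1 : HasDerivAt (fun t => S ((t - a) / w)) (f ((t - a) / w) * (1 / w)) t :=
      (hd _).comp t (((hasDerivAt_id t).sub_const a).div_const w)
    have hd2 : HasDerivAt (fun t => S ((Real.log t - b) / L))
        (f ((Real.log t - b) / L) * (t⁻¹ / L)) t :=
      (hd _).comp t (((Real.hasDerivAt_log ht.ne').sub_const b).div_const L)
    have hd3 := (hasDerivAt_id t).mul ((hd1.sub hd2).const_mul K).exp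
    have hd4 := hd3.deriv
    have hkey : t * g t < 1 + t * (K * (f ((t - a) / w) * (1 / w)
        - f ((Real.log t - b) / L) * (t⁻¹ / L))) := by
      by_cases hta : t ≤ a
      · have h1 : f ((t - a) / w) = 0 :=
          hfl _ (div_nonpos_of_nonpos_of_nonneg (by linarith) hw0.le)
        have h2 := mul_le_mul_of_nonneg_left (hfM ((Real.log t - b) / L)) hK0.le
        have h3 : K * f ((Real.log t - b) / L) / L < 1 := by
          rw [div_lt_one hL0]
          linarith
        rw [h1, hg0 t (by linarith)]
        have h4 : t * (K * (0 * (1 / w) - f ((Real.log t - b) / L) * (t⁻¹ / L)))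
            = - (K * f ((Real.log t - b) / L) / L) := by
          field_simp
          ring
        rw [h4]
        linarith
      · have h2 : f ((Real.log t - b) / L) = 0 := by
          apply hfr
          rw [one_le_div hL0]
          have := Real.log_le_log ha0 (show a ≤ t by linarith)
          linarith
        rw [h2, zero_mul, sub_zero, mul_one_div]
        have h3 : 0 ≤ t * (K * (f ((t - a) / w) / w)) :=
          mul_nonneg ht.le (mul_nonneg hK0.le (div_nonneg (hf0 _) hw0.le))
        by_cases h4 : t ≤ r₁ / 2
        · rw [hg0 t h4]
          linarith
        by_cases h5 : t ≤ s
        · have := mul_le_mul_of_nonneg_left (hK t (by linarith) h5) ht.le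
          linarith
        · have := hs t (by linarith)
          linarith
    have hE : 0 < Real.exp (K * (S ((t - a) / w) - S ((Real.log t - b) / L))) := Real.exp_pos _
    have hfin := mul_lt_mul_of_pos_right hkey hE
    refine lt_of_lt_of_eq ?_ hd4.symm
    simp only [id, Pi.sub_apply]
    linarith

/-- given a smooth path `A` of invertible operators which is constant for
`t ≤ r₁/2` and equal to the identity for `t ≥ r₁`, there exist `r₀ ∈ (0, r₁)` and a smooth
positive function `μ` on `(0,∞)` with `μ(t) = t` for `t ≤ r₀` and for `t ≥ r₁`, satisfying
`μ′(t) > ‖A(t)⁻¹ A′(t)‖ μ(t)` for every `t > 0`. -/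
theorem exists_mu_dominating_growth
    {H : Type*} [NormedAddCommGroup H] [InnerProductSpace ℝ H] [CompleteSpace H]
    (r₁ : ℝ) (hr₁ : 0 < r₁) (A : ℝ → (H ≃L[ℝ] H))
    (hA : ContDiff ℝ (⊤ : ℕ∞) (fun t => (A t : H →L[ℝ] H)))
    (hAconst : ∀ t : ℝ, t ≤ r₁ / 2 → A t = A 0)
    (hAid : ∀ t : ℝ, r₁ ≤ t → (A t : H →L[ℝ] H) = ContinuousLinearMap.id ℝ H) :
    ∃ (r₀ : ℝ) (μ : ℝ → ℝ), 0 < r₀ ∧ r₀ < r₁ ∧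
      ContDiffOn ℝ (⊤ : ℕ∞) μ (Set.Ioi (0 : ℝ)) ∧
      (∀ t : ℝ, 0 < t → 0 < μ t) ∧
      (∀ t : ℝ, 0 < t → t ≤ r₀ → μ t = t) ∧
      (∀ t : ℝ, r₁ ≤ t → μ t = t) ∧
      (∀ t : ℝ, 0 < t →
        ‖((A t).symm : H →L[ℝ] H).comp (deriv (fun s : ℝ => (A s : H →L[ℝ] H)) t)‖ * μ t
          < deriv μ t) := by
  set B : ℝ → (H →L[ℝ] H) := fun s : ℝ => (A s : H →L[ℝ] H) with hB
  have hdc : Continuous (deriv B) := hA.continuous_deriv (by simp)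
  have hl : ∀ t, t ≤ r₁ / 2 → deriv B t = 0 := by
    have hcl : IsClosed {t | deriv B t = 0} := isClosed_eq hdc continuous_const
    have hsub : Set.Iio (r₁ / 2) ⊆ {t | deriv B t = 0} := by
      intro t ht
      have : B =ᶠ[nhds t] fun _ => (A 0 : H →L[ℝ] H) := by
        filter_upwards [Iio_mem_nhds ht] with u hu
        simp only [hB, hAconst u (le_of_lt hu)]
      simp [this.deriv_eq]
    have := closure_minimal hsub hcl
    rw [closure_Iio] at this
    exact fun t ht => this ht
  have hr : ∀ t, r₁ ≤ t → deriv B t = 0 := by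
    have hcl : IsClosed {t | deriv B t = 0} := isClosed_eq hdc continuous_const
    have hsub : Set.Ioi r₁ ⊆ {t | deriv B t = 0} := by
      intro t ht
      have : B =ᶠ[nhds t] fun _ => ContinuousLinearMap.id ℝ H := by
        filter_upwards [Ioi_mem_nhds ht] with u hu
        exact hAid u (le_of_lt hu)
      simp [this.deriv_eq]
    have := closure_minimal hsub hcl
    rw [closure_Ioi] at this
    exact fun t ht => this ht
  have hinv : Continuous fun t => ((A t).symm : H →L[ℝ] H) := by
    have h1 : (fun t => ((A t).symm : H →L[ℝ] H)) =
        fun t => ContinuousLinearMap.inverse (B t) := by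
      funext t
      exact (ContinuousLinearMap.inverse_equiv (A t)).symm
    rw [h1, continuous_iff_continuousAt]
    intro t
    have h2 : ContinuousAt (ContinuousLinearMap.inverse : (H →L[ℝ] H) → (H →L[ℝ] H)) (B t) :=
      (contDiffAt_map_inverse (𝕜 := ℝ) (n := 0) (A t)).continuousAt
    exact ContinuousAt.comp (f := B) h2 hA.continuous.continuousAt
  refine aux_mu r₁ hr₁ (fun t => ‖((A t).symm : H →L[ℝ] H).comp (deriv B t)‖)
    (hinv.clm_comp hdc).norm ?_ ?_
  · intro t ht
    simp [hl t ht]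
  · intro t ht
    simp [hr t ht]
end

section
/- Let H be a real Hilbert space, let A : ℝ → GL(H) be a smooth map into the bounded invertible operators, and let μ : (0,+∞) → (0,+∞) be a smooth function satisfying μ′(t) > ‖A(t)⁻¹ A′(t)‖ μ(t) for every t > 0. Then for every nonzero v ∈ H, the function t ↦ μ(t)⁻¹ ‖A(t)⁻¹ v‖ is strictly decreasing on (0,+∞). -/
/-- if `A` is a smooth path of invertible operators and `μ` is a smooth
positive function on `(0,∞)` with `μ′(t) > ‖A(t)⁻¹ A′(t)‖ μ(t)` for `t > 0`, then for any
nonzero `v` the function `t ↦ μ(t)⁻¹ ‖A(t)⁻¹ v‖` is strictly decreasing on `(0,∞)`. -/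
theorem strictAntiOn_inv_mu_norm
    {H : Type*} [NormedAddCommGroup H] [InnerProductSpace ℝ H] [CompleteSpace H]
    (A : ℝ → (H ≃L[ℝ] H))
    (hA : ContDiff ℝ (⊤ : ℕ∞) (fun t => (A t : H →L[ℝ] H)))
    (μ : ℝ → ℝ)
    (hμ : ContDiffOn ℝ (⊤ : ℕ∞) μ (Set.Ioi (0 : ℝ)))
    (hμpos : ∀ t : ℝ, 0 < t → 0 < μ t)
    (hμ' : ∀ t : ℝ, 0 < t →
      ‖((A t).symm : H →L[ℝ] H).comp (deriv (fun s : ℝ => (A s : H →L[ℝ] H)) t)‖ * μ t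
        < deriv μ t)
    (v : H) (hv : v ≠ 0) :
    StrictAntiOn (fun t : ℝ => (μ t)⁻¹ * ‖(A t).symm v‖) (Set.Ioi (0 : ℝ)) := by
  have hw : ∀ t : ℝ, HasDerivAt (fun s => (A s).symm v)
      (-(((A t).symm : H →L[ℝ] H).comp (deriv (fun s : ℝ => (A s : H →L[ℝ] H)) t)
        ((A t).symm v))) t := by
    intro t
    have hd : HasDerivAt (fun s : ℝ => (A s : H →L[ℝ] H))
        (deriv (fun s : ℝ => (A s : H →L[ℝ] H)) t) t :=
      ((hA.differentiable (by simp)) t).hasDerivAt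
    have hinv : ∀ s, Ring.inverse (A s : H →L[ℝ] H) = ((A s).symm : H →L[ℝ] H) := by
      intro s
      exact Ring.inverse_unit (ContinuousLinearEquiv.toUnit (A s))
    have h1 := (hasFDerivAt_ringInverse (𝕜 := ℝ) (ContinuousLinearEquiv.toUnit (A t)))
    have h2 := HasFDerivAt.comp_hasDerivAt (f := fun s : ℝ => (A s : H →L[ℝ] H)) t h1 hd
    have h3 := h2.clm_apply (hasDerivAt_const t v)
    have h4 : (fun s => (A s).symm v) =
        fun s => (Ring.inverse ∘ fun s : ℝ => (A s : H →L[ℝ] H)) s v := by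
      funext s
      simp only [Function.comp, hinv]
      rfl
    rw [h4]
    convert h3 using 1
    simp
    rfl
  have hne : ∀ t, (A t).symm v ≠ 0 := fun t h => hv (by simpa using h)
  have hder : ∀ t : ℝ, 0 < t → ∃ d < 0,
      HasDerivAt (fun t : ℝ => (μ t)⁻¹ * ‖(A t).symm v‖) d t := by
    intro t ht
    have hm : HasDerivAt μ (deriv μ t) t :=
      (((hμ.contDiffAt (Ioi_mem_nhds ht)).differentiableAt (by simp))).hasDerivAt
    have hn := (hw t).norm_sq.sqrt (by simpa using hne t)
    simp only [Real.sqrt_sq (norm_nonneg _)] at hn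
    refine ⟨_, ?_, (hm.inv (hμpos t ht).ne').mul hn⟩
    have hμt := hμ' t ht
    have hp := hμpos t ht
    set B := ((A t).symm : H →L[ℝ] H).comp (deriv (fun s : ℝ => (A s : H →L[ℝ] H)) t)
    set w := (A t).symm v with hwdef
    have hwp : 0 < ‖w‖ := norm_pos_iff.2 (hne t)
    have hi : inner ℝ w (-(B w)) ≤ ‖B‖ * ‖w‖ * ‖w‖ := by
      calc inner ℝ w (-(B w)) ≤ ‖w‖ * ‖-(B w)‖ := real_inner_le_norm _ _
        _ ≤ ‖w‖ * (‖B‖ * ‖w‖) := by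
          rw [norm_neg]
          gcongr
          exact B.le_opNorm w
        _ = _ := by ring
    have hq : 2 * inner ℝ w (-(B w)) / (2 * ‖w‖) ≤ ‖B‖ * ‖w‖ := by
      rw [div_le_iff₀ (by positivity)]
      linarith
    have e : -deriv μ t / μ t ^ 2 * ‖w‖ + (μ t)⁻¹ * (2 * inner ℝ w (-(B w)) / (2 * ‖w‖))
        ≤ (‖B‖ * μ t - deriv μ t) * (‖w‖ / μ t ^ 2) := by
      calc _ ≤ -deriv μ t / μ t ^ 2 * ‖w‖ + (μ t)⁻¹ * (‖B‖ * ‖w‖) := by gcongr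
        _ = _ := by field_simp; ring
    refine lt_of_le_of_lt e ?_
    exact mul_neg_of_neg_of_pos (by linarith) (by positivity)
  apply strictAntiOn_of_deriv_neg (convex_Ioi 0)
  · intro t ht
    obtain ⟨d, _, h⟩ := hder t ht
    exact h.continuousAt.continuousWithinAt
  · intro t ht
    rw [interior_Ioi] at ht
    obtain ⟨d, hd, h⟩ := hder t ht
    rw [h.deriv]
    exact hd
end

section
/- Let H be a real Hilbert space, let 0 < r₀ < r₁, let A : ℝ → GL(H) be a smooth map with A(t) = A(0) for t ≤ r₁/2 and A(t) = I for t ≥ r₁, and let μ : (0,+∞) → (0,+∞) be a smooth function with μ(t) = t for t ≤ r₀ and for t ≥ r₁, and μ′(t) > ‖A(t)⁻¹ A′(t)‖ μ(t) for all t > 0. Define φ : H → H by φ(x) = (μ(‖x‖)/‖x‖) A(‖x‖)x for x ≠ 0 and φ(0) = 0. Then φ is a bijection of H onto H; more precisely, for every nonzero v ∈ H there is a unique t > 0 with μ(t)⁻¹‖A(t)⁻¹v‖ = 1, and x = t μ(t)⁻¹ A(t)⁻¹ v is the unique solution of φ(x) = v. -/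
theorem aux_anti
    {H : Type*} [NormedAddCommGroup H] [InnerProductSpace ℝ H] [CompleteSpace H]
    (A : ℝ → (H ≃L[ℝ] H))
    (hA : ContDiff ℝ (⊤ : ℕ∞) (fun t => (A t : H →L[ℝ] H)))
    (μ : ℝ → ℝ)
    (hμ : ContDiffOn ℝ (⊤ : ℕ∞) μ (Set.Ioi (0 : ℝ)))
    (hμpos : ∀ t : ℝ, 0 < t → 0 < μ t)
    (hμ' : ∀ t : ℝ, 0 < t →
      ‖((A t).symm : H →L[ℝ] H).comp (deriv (fun s : ℝ => (A s : H →L[ℝ] H)) t)‖ * μ t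
        < deriv μ t) (v : H) (hv : v ≠ 0) :
    ContinuousOn (fun t => (μ t)⁻¹ * ‖(A t).symm v‖) (Set.Ioi 0) ∧
    StrictAntiOn (fun t => (μ t)⁻¹ * ‖(A t).symm v‖) (Set.Ioi 0) := by
  have hAd : ∀ t, HasDerivAt (fun s : ℝ => (A s : H →L[ℝ] H))
      (deriv (fun s : ℝ => (A s : H →L[ℝ] H)) t) t := fun t =>
    ((hA.differentiable (by simp)) t).hasDerivAt
  have hwdiff : ∀ t, DifferentiableAt ℝ (fun s => (A s).symm v) t := by
    intro t
    have h1 : ContDiffAt ℝ 1 (ContinuousLinearMap.inverse : (H →L[ℝ] H) → (H →L[ℝ] H))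
      (A t : H →L[ℝ] H) := contDiffAt_map_inverse (A t)
    have h2 := (h1.differentiableAt (by simp)).comp t (hAd t).differentiableAt
    have h3 := h2.clm_apply (differentiableAt_const v)
    simpa [Function.comp_def] using h3
  have hw : ∀ t, HasDerivAt (fun s => (A s).symm v)
      (-(((A t).symm : H →L[ℝ] H).comp (deriv (fun s : ℝ => (A s : H →L[ℝ] H)) t)
        ((A t).symm v))) t := by
    intro t
    have h1 := (hwdiff t).hasDerivAt
    have h2 := (hAd t).clm_apply h1
    have h3 : HasDerivAt (fun s => (A s : H →L[ℝ] H) ((A s).symm v)) 0 t := by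
      simpa using hasDerivAt_const t v
    have h4 := h2.unique h3
    have h5 : deriv (fun s => (A s).symm v) t =
      (-(((A t).symm : H →L[ℝ] H).comp (deriv (fun s : ℝ => (A s : H →L[ℝ] H)) t)
        ((A t).symm v))) := by
      have h6 := congrArg (A t).symm h4
      simp only [map_add, map_zero, ContinuousLinearEquiv.coe_coe,
        ContinuousLinearEquiv.symm_apply_apply] at h6
      simpa using eq_neg_of_add_eq_zero_right h6
    rwa [h5] at h1
  have hμd : ∀ t, 0 < t → HasDerivAt μ (deriv μ t) t := fun t ht =>
    ((hμ.differentiableOn (by simp)).differentiableAt (Ioi_mem_nhds ht)).hasDerivAt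
  have hcont : ContinuousOn (fun t => (μ t)⁻¹ * ‖(A t).symm v‖) (Set.Ioi 0) := by
    intro t ht
    exact (((hμd t ht).continuousAt.inv₀ (hμpos t ht).ne').mul
      (hwdiff t).continuousAt.norm).continuousWithinAt
  refine ⟨hcont, ?_⟩
  have hsq : StrictAntiOn (fun t => ((μ t)⁻¹ * ‖(A t).symm v‖) ^ 2) (Set.Ioi 0) := by
    apply strictAntiOn_of_deriv_neg (convex_Ioi 0) (hcont.pow 2)
    intro t ht
    rw [interior_Ioi] at ht
    have hm := hμpos t ht
    have hd := (((hμd t ht).inv hm.ne').pow 2).mul (hw t).norm_sq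
    have he : ((fun t => (μ t)⁻¹ * ‖(A t).symm v‖) ^ 2) =
      (μ⁻¹ ^ 2 * fun t => ‖(A t).symm v‖ ^ 2) := by
      ext s; simp [mul_pow]
    rw [he, hd.deriv]
    have hlt := hμ' t ht
    set B := ((A t).symm : H →L[ℝ] H).comp (deriv (fun s : ℝ => (A s : H →L[ℝ] H)) t)
    set w := (A t).symm v with hwdef
    have hw0 : 0 < ‖w‖ := by
      rw [norm_pos_iff, hwdef]; simpa using hv
    have hin : inner ℝ w (-(B w)) ≤ ‖B‖ * ‖w‖ ^ 2 := by
      calc inner ℝ w (-(B w)) ≤ ‖w‖ * ‖-(B w)‖ := real_inner_le_norm _ _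
        _ ≤ ‖w‖ * (‖B‖ * ‖w‖) := by rw [norm_neg]; gcongr; exact B.le_opNorm w
        _ = _ := by ring
    have key : inner ℝ w (-(B w)) * μ t - ‖w‖ ^ 2 * deriv μ t < 0 := by
      have := mul_le_mul_of_nonneg_right hin hm.le
      have := mul_lt_mul_of_pos_left hlt (pow_pos hw0 2)
      nlinarith
    have : 2 / (μ t) ^ 3 * (inner ℝ w (-(B w)) * μ t - ‖w‖ ^ 2 * deriv μ t) < 0 :=
      mul_neg_of_pos_of_neg (by positivity) key
    convert this using 1
    simp only [Pi.pow_apply, Pi.inv_apply, show (2 - 1 : ℕ) = 1 from rfl, pow_one]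
    field_simp
    push_cast
    ring
  intro a ha b hb hab
  have hpos : 0 ≤ (μ a)⁻¹ * ‖(A a).symm v‖ :=
    mul_nonneg (inv_nonneg.2 (hμpos a ha).le) (norm_nonneg _)
  exact lt_of_pow_lt_pow_left₀ 2 hpos (hsq ha hb hab)

/-- the map `φ(x) = (μ(‖x‖)/‖x‖) A(‖x‖) x`, `φ(0) = 0`, is a bijection of
`H`: for every nonzero `v` there is a unique `t > 0` with `μ(t)⁻¹ ‖A(t)⁻¹ v‖ = 1`, and
`x = t μ(t)⁻¹ A(t)⁻¹ v` is the unique solution of `φ(x) = v`. -/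
theorem phi_bijective
    {H : Type*} [NormedAddCommGroup H] [InnerProductSpace ℝ H] [CompleteSpace H]
    (r₀ r₁ : ℝ) (hr₀ : 0 < r₀) (hr₀₁ : r₀ < r₁)
    (A : ℝ → (H ≃L[ℝ] H))
    (hA : ContDiff ℝ (⊤ : ℕ∞) (fun t => (A t : H →L[ℝ] H)))
    (hAconst : ∀ t : ℝ, t ≤ r₁ / 2 → A t = A 0)
    (hAid : ∀ t : ℝ, r₁ ≤ t → (A t : H →L[ℝ] H) = ContinuousLinearMap.id ℝ H)
    (μ : ℝ → ℝ)
    (hμ : ContDiffOn ℝ (⊤ : ℕ∞) μ (Set.Ioi (0 : ℝ)))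
    (hμpos : ∀ t : ℝ, 0 < t → 0 < μ t)
    (hμeq : ∀ t : ℝ, 0 < t → (t ≤ r₀ ∨ r₁ ≤ t) → μ t = t)
    (hμ' : ∀ t : ℝ, 0 < t →
      ‖((A t).symm : H →L[ℝ] H).comp (deriv (fun s : ℝ => (A s : H →L[ℝ] H)) t)‖ * μ t
        < deriv μ t)
    (φ : H → H)
    (hφ : ∀ x : H, x ≠ 0 → φ x = (μ ‖x‖ / ‖x‖) • (A ‖x‖) x)
    (hφ0 : φ 0 = 0) :
    Function.Bijective φ ∧
      ∀ v : H, v ≠ 0 →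
        (∃! t : ℝ, 0 < t ∧ (μ t)⁻¹ * ‖(A t).symm v‖ = 1) ∧
        (∀ t : ℝ, 0 < t → (μ t)⁻¹ * ‖(A t).symm v‖ = 1 →
          ∀ x : H, φ x = v ↔ x = (t * (μ t)⁻¹) • (A t).symm v) := by
  have main : ∀ v : H, v ≠ 0 →
        (∃! t : ℝ, 0 < t ∧ (μ t)⁻¹ * ‖(A t).symm v‖ = 1) ∧
        (∀ t : ℝ, 0 < t → (μ t)⁻¹ * ‖(A t).symm v‖ = 1 →
          ∀ x : H, φ x = v ↔ x = (t * (μ t)⁻¹) • (A t).symm v) := by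
    intro v hv
    obtain ⟨hc, hanti⟩ := aux_anti A hA μ hμ hμpos hμ' v hv
    have huniq : ∀ s t : ℝ, 0 < s → 0 < t → (μ s)⁻¹ * ‖(A s).symm v‖ = 1 →
        (μ t)⁻¹ * ‖(A t).symm v‖ = 1 → s = t := fun s t hs ht h1 h2 =>
      hanti.injOn hs ht (h1.trans h2.symm)
    refine ⟨?_, ?_⟩
    · have hw0 : 0 < ‖(A 0).symm v‖ := by
        rw [norm_pos_iff]; simpa using hv
      obtain ⟨a, ha0, har0, har1, hav⟩ : ∃ a : ℝ, 0 < a ∧ a ≤ r₀ ∧ a ≤ r₁ / 2 ∧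
          a ≤ ‖(A 0).symm v‖ :=
        ⟨min r₀ (min (r₁ / 2) ‖(A 0).symm v‖),
          lt_min hr₀ (lt_min (by linarith) hw0), min_le_left _ _,
          (min_le_right _ _).trans (min_le_left _ _),
          (min_le_right _ _).trans (min_le_right _ _)⟩
      obtain ⟨b, hb1, hbv⟩ : ∃ b : ℝ, r₁ ≤ b ∧ ‖v‖ ≤ b :=
        ⟨max r₁ ‖v‖, le_max_left _ _, le_max_right _ _⟩
      have hab : a ≤ b := by linarith
      have hb0 : 0 < b := by linarith
      have hfa : 1 ≤ (μ a)⁻¹ * ‖(A a).symm v‖ := by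
        rw [hμeq a ha0 (Or.inl har0), hAconst a har1, inv_mul_eq_div, one_le_div ha0]
        exact hav
      have hfb : (μ b)⁻¹ * ‖(A b).symm v‖ ≤ 1 := by
        have h : (A b).symm v = v := by
          rw [ContinuousLinearEquiv.symm_apply_eq]
          have := congrArg (fun L : H →L[ℝ] H => L v) (hAid b hb1)
          simpa using this.symm
        rw [hμeq b hb0 (Or.inr hb1), h, inv_mul_eq_div, div_le_one hb0]
        exact hbv
      obtain ⟨t, ht, hft⟩ := intermediate_value_Icc' hab
        (hc.mono (fun s hs => lt_of_lt_of_le ha0 hs.1)) ⟨hfb, hfa⟩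
      have ht0 : 0 < t := lt_of_lt_of_le ha0 ht.1
      exact ⟨t, ⟨ht0, hft⟩, fun s hs => huniq s t hs.1 ht0 hs.2 hft⟩
    · intro t ht hft x
      constructor
      · intro hx
        have hx0 : x ≠ 0 := by
          rintro rfl
          exact hv (hx.symm.trans hφ0)
        have hs : 0 < ‖x‖ := norm_pos_iff.2 hx0
        have hm := hμpos _ hs
        rw [hφ x hx0] at hx
        have hw : (A ‖x‖).symm v = (μ ‖x‖ / ‖x‖) • x := by
          rw [← hx]; simp
        have hst : ‖x‖ = t := by
          apply huniq _ _ hs ht _ hft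
          rw [hw, norm_smul, Real.norm_of_nonneg (by positivity)]
          field_simp
        rw [← hst, hw, smul_smul]
        have : ‖x‖ * (μ ‖x‖)⁻¹ * (μ ‖x‖ / ‖x‖) = 1 := by field_simp
        rw [this, one_smul]
      · intro hx
        have hm := hμpos _ ht
        have hn : ‖x‖ = t := by
          rw [hx, norm_smul, Real.norm_of_nonneg (by positivity), mul_assoc, hft, mul_one]
        have hx0 : x ≠ 0 := by
          rw [← norm_pos_iff, hn]; exact ht
        rw [hφ x hx0, hn, hx, map_smul, smul_smul, ContinuousLinearEquiv.apply_symm_apply]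
        have : μ t / t * (t * (μ t)⁻¹) = 1 := by field_simp
        rw [this, one_smul]
  refine ⟨⟨?_, ?_⟩, main⟩
  · have hne : ∀ x, φ x = 0 → x = 0 := by
      intro x hx
      by_contra hx0
      have hs : 0 < ‖x‖ := norm_pos_iff.2 hx0
      have hm := hμpos _ hs
      rw [hφ x hx0, smul_eq_zero] at hx
      rcases hx with h | h
      · exact (div_pos hm hs).ne' h
      · exact hx0 (by simpa using h)
    intro x y hxy
    by_cases hv : φ y = 0
    · rw [hne y hv, hne x (hxy.trans hv)]
    · obtain ⟨⟨t, ⟨ht, hft⟩, -⟩, h⟩ := main (φ y) hv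
      rw [(h t ht hft x).1 hxy]
      exact ((h t ht hft y).1 rfl).symm
  · intro v
    by_cases hv : v = 0
    · exact ⟨0, by rw [hφ0, hv]⟩
    · obtain ⟨⟨t, ⟨ht, hft⟩, -⟩, h⟩ := main v hv
      exact ⟨_, (h t ht hft _).2 rfl⟩
end

section
/- Let H be a real Hilbert space, let 0 < r₀ < r₁, let A : ℝ → GL(H) be a smooth map with A(t) = A(0) for t ≤ r₁/2 and A(t) = I for t ≥ r₁, and let μ : (0,+∞) → (0,+∞) be a smooth function with μ(t) = t for t ≤ r₀ and for t ≥ r₁, and μ′(t) > ‖A(t)⁻¹ A′(t)‖ μ(t) for all t > 0. Define φ : H → H by φ(x) = (μ(‖x‖)/‖x‖) A(‖x‖)x for x ≠ 0 and φ(0) = 0. Then φ is smooth and for every x ∈ H the Fréchet derivative Dφ(x) is a bounded invertible linear operator on H. -/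
/-- Rank-one perturbation of a nonzero homothety. -/
theorem rank_one_equiv {H : Type*} [NormedAddCommGroup H] [InnerProductSpace ℝ H]
    (c : ℝ) (hc : c ≠ 0) (u w : H) (h : c + inner ℝ u w ≠ 0) :
    ∃ E : H ≃L[ℝ] H, ∀ k : H, E k = c • k + (inner ℝ u k : ℝ) • w := by
  let f : H →L[ℝ] H := c • ContinuousLinearMap.id ℝ H + (innerSL ℝ u).smulRight w
  let g : H →L[ℝ] H := c⁻¹ • (ContinuousLinearMap.id ℝ H
    - (c + inner ℝ u w)⁻¹ • (innerSL ℝ u).smulRight w)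
  have hf : ∀ k, f k = c • k + (inner ℝ u k : ℝ) • w := fun k => by simp [f]
  have hg : ∀ k, g k = c⁻¹ • (k - (c + inner ℝ u w)⁻¹ • (inner ℝ u k : ℝ) • w) :=
    fun k => by simp [g]
  refine ⟨ContinuousLinearEquiv.equivOfInverse f g ?_ ?_, ?_⟩
  · intro k
    rw [hg, hf, inner_add_right, inner_smul_right, inner_smul_right]
    match_scalars
    · field_simp
    · field_simp
      ring
  · intro k
    rw [hf, hg, inner_smul_right, inner_sub_right, inner_smul_right, inner_smul_right]
    match_scalars
    · field_simp
    · field_simp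
      ring
  · intro k
    exact hf k

/-- the map `φ(x) = (μ(‖x‖)/‖x‖) A(‖x‖) x`, `φ(0) = 0`, is smooth and its
Fréchet derivative at every point is an invertible bounded operator. -/
theorem phi_smooth_with_invertible_derivative
    {H : Type*} [NormedAddCommGroup H] [InnerProductSpace ℝ H] [CompleteSpace H]
    (r₀ r₁ : ℝ) (hr₀ : 0 < r₀) (hr₀₁ : r₀ < r₁)
    (A : ℝ → (H ≃L[ℝ] H))
    (hA : ContDiff ℝ (⊤ : ℕ∞) (fun t => (A t : H →L[ℝ] H)))
    (hAconst : ∀ t : ℝ, t ≤ r₁ / 2 → A t = A 0)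
    (hAid : ∀ t : ℝ, r₁ ≤ t → (A t : H →L[ℝ] H) = ContinuousLinearMap.id ℝ H)
    (μ : ℝ → ℝ)
    (hμ : ContDiffOn ℝ (⊤ : ℕ∞) μ (Set.Ioi (0 : ℝ)))
    (hμpos : ∀ t : ℝ, 0 < t → 0 < μ t)
    (hμeq : ∀ t : ℝ, 0 < t → (t ≤ r₀ ∨ r₁ ≤ t) → μ t = t)
    (hμ' : ∀ t : ℝ, 0 < t →
      ‖((A t).symm : H →L[ℝ] H).comp (deriv (fun s : ℝ => (A s : H →L[ℝ] H)) t)‖ * μ t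
        < deriv μ t)
    (φ : H → H)
    (hφ : ∀ x : H, x ≠ 0 → φ x = (μ ‖x‖ / ‖x‖) • (A ‖x‖) x)
    (hφ0 : φ 0 = 0) :
    ContDiff ℝ (⊤ : ℕ∞) φ ∧
      ∀ x : H, ∃ D : H ≃L[ℝ] H, HasFDerivAt φ (D : H →L[ℝ] H) x := by
  have hr₁ : 0 < r₁ := hr₀.trans hr₀₁
  -- near the origin the map is linear
  have hzero : φ =ᶠ[nhds 0] fun x => (A 0) x := by
    filter_upwards [Metric.ball_mem_nhds (0 : H) (lt_min hr₀ (half_pos hr₁))] with x hx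
    rw [mem_ball_zero_iff, lt_min_iff] at hx
    by_cases h0 : x = 0
    · simp [h0, hφ0]
    · have hn : 0 < ‖x‖ := norm_pos_iff.mpr h0
      rw [hφ x h0, hμeq _ hn (Or.inl hx.1.le), hAconst _ hx.2.le, div_self hn.ne', one_smul]
  have hloc : ∀ x : H, x ≠ 0 → φ =ᶠ[nhds x] fun y =>
      (μ ‖y‖ / ‖y‖) • ((fun t => (A t : H →L[ℝ] H)) ‖y‖) y := by
    intro x hx
    filter_upwards [isOpen_ne.mem_nhds hx] with y hy
    exact hφ y hy
  constructor
  · rw [contDiff_iff_contDiffAt]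
    intro x
    by_cases hx : x = 0
    · subst hx
      exact ((A 0).contDiff.contDiffAt).congr_of_eventuallyEq hzero
    · refine ContDiffAt.congr_of_eventuallyEq ?_ (hloc x hx)
      have hn : 0 < ‖x‖ := norm_pos_iff.mpr hx
      have h1 : ContDiffAt ℝ (⊤ : ℕ∞) (fun y : H => ‖y‖) x := contDiffAt_norm ℝ hx
      have h2 : ContDiffAt ℝ (⊤ : ℕ∞) (fun y : H => μ ‖y‖) x :=
        ((hμ.contDiffAt (Ioi_mem_nhds hn)).comp x h1 :)
      have h3 : ContDiffAt ℝ (⊤ : ℕ∞) (fun y : H => (fun t => (A t : H →L[ℝ] H)) ‖y‖) x :=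
        (hA.contDiffAt.comp x h1 :)
      exact (h2.div h1 hn.ne').smul (h3.clm_apply contDiffAt_id)
  · intro x
    by_cases hx : x = 0
    · subst hx
      exact ⟨A 0, (A 0).hasFDerivAt.congr_of_eventuallyEq hzero⟩
    have hn : 0 < ‖x‖ := norm_pos_iff.mpr hx
    obtain ⟨t, ht⟩ : ∃ t, t = ‖x‖ := ⟨_, rfl⟩
    have htp : 0 < t := ht ▸ hn
    have dμ : HasDerivAt μ (deriv μ t) t :=
      ((hμ.contDiffAt (Ioi_mem_nhds htp)).differentiableAt (by simp)).hasDerivAt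
    have dA : HasDerivAt (fun s => (A s : H →L[ℝ] H))
        (deriv (fun s : ℝ => (A s : H →L[ℝ] H)) t) t :=
      (hA.contDiffAt.differentiableAt (by simp)).hasDerivAt
    have key := hμ' t htp
    generalize deriv μ t = μ' at *
    generalize deriv (fun s : ℝ => (A s : H →L[ℝ] H)) t = A' at *
    have dn : HasFDerivAt (fun y : H => ‖y‖) (innerSL ℝ (t⁻¹ • x)) x := by
      have := (hasStrictFDerivAt_norm_sq x).hasFDerivAt.sqrt (by positivity)
      simp only [Real.sqrt_sq (norm_nonneg _)] at this
      convert this using 1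
      ext k
      simp [← ht]
      field_simp
    have dm := dμ.div (hasDerivAt_id t) htp.ne'
    rw [ht] at dm dA
    have dm2 := dm.comp_hasFDerivAt x dn
    have dA2 := dA.hasFDerivAt.comp x dn
    have dφ := (dm2.smul (dA2.clm_apply (hasFDerivAt_id x))).congr_of_eventuallyEq (hloc x hx)
    have hμt := hμpos t htp
    set B : H →L[ℝ] H := ((A t).symm : H →L[ℝ] H).comp A' with hB
    have hin : |inner ℝ (t⁻¹ • x) (B (t⁻¹ • x))| ≤ ‖B‖ := by
      have hu1 : ‖t⁻¹ • x‖ = 1 := by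
        rw [norm_smul, norm_inv, Real.norm_of_nonneg htp.le, ← ht, inv_mul_cancel₀ htp.ne']
      calc _ ≤ ‖t⁻¹ • x‖ * ‖B (t⁻¹ • x)‖ := abs_real_inner_le_norm _ _
        _ ≤ ‖t⁻¹ • x‖ * (‖B‖ * ‖t⁻¹ • x‖) := by gcongr; exact B.le_opNorm _
        _ = ‖B‖ := by rw [hu1]; ring
    have hxx : inner ℝ x x = t ^ 2 := by rw [real_inner_self_eq_norm_sq, ht]
    obtain ⟨E, hE⟩ := rank_one_equiv (μ t / t) (by positivity) (t⁻¹ • x)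
      (((μ' * t - μ t) / t ^ 2) • x + (μ t / t) • B x) (by
        have e : μ t / t + inner ℝ (t⁻¹ • x) (((μ' * t - μ t) / t ^ 2) • x + (μ t / t) • B x)
            = μ' + μ t * inner ℝ (t⁻¹ • x) (B (t⁻¹ • x)) := by
          simp only [inner_add_right, inner_smul_right, inner_smul_left, map_smul, hxx,
            RCLike.conj_to_real]
          field_simp
          ring
        rw [e]
        have := (abs_le.mp hin).1
        nlinarith)
    refine ⟨E.trans (A t), ?_⟩
    convert dφ using 1
    ext k
    have hAB : ∀ v, A t (B v) = A' v := fun v => by simp [hB]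
    simp [hE, hAB, ← ht, inner_smul_left]
    module
end

section
/- Let H be a real Hilbert space and let f : H → ℝ be a smooth function such that f(0) = 0, Df(0) = 0, and the second derivative of f at 0 is represented by a bounded invertible self-adjoint operator A on H, i.e. D²f(0)[u,v] = ⟨Au, v⟩ for all u,v ∈ H. Then for every r₁ > 0 there exist r₀ > 0 and a smooth diffeomorphism φ : H → H such that φ(u) = u for all ‖u‖ ≥ r₁, φ(0) = 0, Dφ(0) = I, and f(u) = (1/2)⟨A φ(u), φ(u)⟩ for every u with ‖u‖ ≤ r₀. -/
open RealInnerProductSpace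
open scoped ContDiff Topology

universe u

theorem aux_hasFDerivAt_radial {E F : Type u} [NormedAddCommGroup E] [NormedSpace ℝ E]
    [NormedAddCommGroup F] [NormedSpace ℝ F] (k : ℝ → ℝ) (hk : Continuous k)
    (G : E → F) (hG : ContDiff ℝ ∞ G) (u : E) :
    HasFDerivAt (fun u => ∫ t in (0:ℝ)..1, k t • G (t • u))
      (∫ t in (0:ℝ)..1, (k t * t) • fderiv ℝ G (t • u)) u := by
  have hGc : Continuous G := hG.continuous
  have hdG : Continuous (fderiv ℝ G) := hG.continuous_fderiv (by simp)
  have hc : Continuous (fun z : E × ℝ => ‖(k z.2 * z.2) • fderiv ℝ G (z.2 • z.1)‖) := by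
    fun_prop
  obtain ⟨M, hM⟩ := (isCompact_Icc (a := (0:ℝ)) (b := 1)).exists_bound_of_continuousOn
    (f := fun t : ℝ => (k t * t) • fderiv ℝ G (t • u)) (by fun_prop)
  have hev : ∀ᶠ x in 𝓝 u, ∀ t ∈ Set.Icc (0:ℝ) 1,
      ‖(k t * t) • fderiv ℝ G (t • x)‖ < M + 1 := by
    apply isCompact_Icc.eventually_forall_of_forall_eventually
    intro t ht
    have := hM t ht
    exact hc.continuousAt.eventually_lt continuousAt_const (by simpa using by linarith)
  apply intervalIntegral.hasFDerivAt_integral_of_dominated_of_fderiv_le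
    (F' := fun x t => (k t * t) • fderiv ℝ G (t • x)) (bound := fun _ => M + 1) hev
  · exact Filter.Eventually.of_forall fun x => Continuous.aestronglyMeasurable (by fun_prop)
  · exact Continuous.intervalIntegrable (by fun_prop) _ _
  · exact Continuous.aestronglyMeasurable (by fun_prop)
  · refine Filter.Eventually.of_forall fun t ht x hx => (hx t ?_).le
    rw [Set.uIoc_of_le zero_le_one] at ht
    exact ⟨ht.1.le, ht.2⟩
  · exact Continuous.intervalIntegrable (by fun_prop) _ _
  · refine Filter.Eventually.of_forall fun t ht x hx => ?_
    have h1 : HasFDerivAt G (fderiv ℝ G (t • x)) (t • x) :=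
      (hG.differentiable (by simp) _).hasFDerivAt
    have h2 : HasFDerivAt (fun x : E => t • x) (t • ContinuousLinearMap.id ℝ E) x :=
      (hasFDerivAt_id x).const_smul t
    have h3 := (h1.comp x h2).const_smul (k t)
    refine HasFDerivAt.congr_fderiv (f := fun x : E => k t • G (t • x)) h3 ?_
    ext v
    simp [mul_smul]

theorem aux_contDiff_radial {E : Type u} [NormedAddCommGroup E] [NormedSpace ℝ E] (n : ℕ) :
    ∀ {F : Type u} [NormedAddCommGroup F] [NormedSpace ℝ F] (k : ℝ → ℝ) (_ : Continuous k)
    (G : E → F) (_ : ContDiff ℝ ∞ G),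
    ContDiff ℝ n (fun u => ∫ t in (0:ℝ)..1, k t • G (t • u)) := by
  induction n with
  | zero =>
    intro F _ _ k hk G hG
    have hGc : Continuous G := hG.continuous
    apply contDiff_zero.2
    apply intervalIntegral.continuous_parametric_intervalIntegral_of_continuous'
    unfold Function.uncurry
    fun_prop
  | succ n ih =>
    intro F _ _ k hk G hG
    have h := aux_hasFDerivAt_radial k hk G hG
    push_cast
    rw [contDiff_succ_iff_fderiv]
    refine ⟨fun u => (h u).differentiableAt, by simp, ?_⟩
    have : fderiv ℝ (fun u => ∫ t in (0:ℝ)..1, k t • G (t • u)) =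
        fun u => ∫ t in (0:ℝ)..1, (k t * t) • fderiv ℝ G (t • u) := by
      ext1 u; exact (h u).fderiv
    rw [this]
    exact ih (fun t => k t * t) (by fun_prop) (fderiv ℝ G) (hG.fderiv_right (by simp))

theorem aux_sqrt {R : Type u} [NormedRing R] [NormedAlgebra ℝ R] [CompleteSpace R] :
    ∃ S : R → R, S 1 = 1 ∧ ContDiffAt ℝ ω S 1 ∧ (∀ᶠ y in 𝓝 1, S y * S y = y) ∧
      ∀ᶠ x in 𝓝 1, S (x * x) = x := by
  let e : R ≃L[ℝ] R := ContinuousLinearEquiv.smulLeft (Units.mk0 (2:ℝ) two_ne_zero)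
  have hd : HasFDerivAt (fun x : R => x * x) (e : R →L[ℝ] R) 1 := by
    refine HasFDerivAt.congr_fderiv (f := fun x : R => x * x)
      ((hasFDerivAt_id (𝕜 := ℝ) (1:R)).mul' (hasFDerivAt_id (𝕜 := ℝ) (1:R))) ?_
    ext v
    simp [e, two_smul, Units.smul_def]
  have hc : ContDiffAt ℝ ω (fun x : R => x * x) 1 := contDiffAt_id.mul contDiffAt_id
  have hs := hc.hasStrictFDerivAt' hd (by simp)
  refine ⟨hc.localInverse hd (by simp), ?_, ?_, ?_, ?_⟩
  · simpa using hc.localInverse_apply_image hd (by simp)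
  · simpa using hc.to_localInverse hd (by simp)
  · have := hs.eventually_right_inverse
    simp only [mul_one] at this
    exact this
  · exact hs.eventually_left_inverse

theorem aux_global {H : Type u} [NormedAddCommGroup H] [NormedSpace ℝ H] [CompleteSpace H]
    (ψ : H → H) (hψ : ContDiff ℝ ∞ ψ) (hb : ∀ u, ‖fderiv ℝ ψ u‖ ≤ 1 / 2) :
    ∃ φinv : H → H, ContDiff ℝ ∞ φinv ∧ Function.LeftInverse φinv (fun u => u + ψ u) ∧
      Function.RightInverse φinv (fun u => u + ψ u) := by
  have hd : Differentiable ℝ ψ := hψ.differentiable (by simp)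
  have hL : LipschitzWith (1/2) ψ := lipschitzWith_of_nnnorm_fderiv_le hd fun x => by
    rw [← NNReal.coe_le_coe]; simpa using hb x
  have hA : ApproximatesLinearOn (fun u => u + ψ u)
      ((ContinuousLinearEquiv.refl ℝ H : H ≃L[ℝ] H) : H →L[ℝ] H) Set.univ (1/2) := by
    intro x _ y _
    have := hL.norm_sub_le x y
    have h2 : x + ψ x - (y + ψ y) - ((ContinuousLinearEquiv.refl ℝ H : H ≃L[ℝ] H) : H →L[ℝ] H) (x - y)
        = ψ x - ψ y := by
      simp only [ContinuousLinearEquiv.coe_refl, ContinuousLinearMap.id_apply]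
      abel
    change ‖x + ψ x - (y + ψ y) - ((ContinuousLinearEquiv.refl ℝ H : H ≃L[ℝ] H) : H →L[ℝ] H) (x - y)‖ ≤ _
    rw [h2]
    exact this
  have hc : Subsingleton H ∨
      (1/2 : NNReal) < ‖((ContinuousLinearEquiv.refl ℝ H).symm : H →L[ℝ] H)‖₊⁻¹ := by
    rcases subsingleton_or_nontrivial H with h | h
    · exact Or.inl h
    · right
      have : ‖((ContinuousLinearEquiv.refl ℝ H).symm : H →L[ℝ] H)‖₊ = 1 := by
        ext; simp
      rw [this]
      rw [← NNReal.coe_lt_coe]; norm_num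
  let Φ := hA.toHomeomorph _ hc
  have hΦ : ⇑Φ = fun u => u + ψ u := rfl
  have hlt : ∀ u, ‖-fderiv ℝ ψ u‖ < 1 := fun u => by
    rw [norm_neg]; linarith [hb u]
  refine ⟨Φ.symm, ?_, Φ.left_inv, Φ.right_inv⟩
  refine Φ.contDiff_symm (f₀' := fun u => ContinuousLinearEquiv.unitsEquiv ℝ H
    (Units.oneSub (-fderiv ℝ ψ u) (hlt u))) ?_ ?_
  · intro a
    rw [hΦ]
    refine HasFDerivAt.congr_fderiv (f := fun u => u + ψ u)
      ((hasFDerivAt_id a).add (hd a).hasFDerivAt) ?_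
    ext v
    change v + fderiv ℝ ψ a v = v - (-fderiv ℝ ψ a) v
    simp
  · rw [hΦ]; exact contDiff_id.add hψ

theorem aux_cutoff {H : Type u} [NormedAddCommGroup H] [InnerProductSpace ℝ H]
    (g : H → H) (hg : ∀ᶠ u in 𝓝 0, ContDiffAt ℝ ∞ g u) (g0 : g 0 = 0)
    (dg0 : fderiv ℝ g 0 = 0) (r₁ : ℝ) (hr₁ : 0 < r₁) :
    ∃ (r₀ : ℝ) (ψ : H → H), 0 < r₀ ∧ ContDiff ℝ ∞ ψ ∧ (∀ u, ‖fderiv ℝ ψ u‖ ≤ 1 / 2) ∧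
      (∀ u, r₁ ≤ ‖u‖ → ψ u = 0) ∧ (∀ u, ‖u‖ ≤ r₀ → ψ u = g u) := by
  have hst : ContDiff ℝ ∞ Real.smoothTransition := Real.smoothTransition.contDiff
  have hdst : Continuous (deriv Real.smoothTransition) := hst.continuous_deriv (by simp)
  obtain ⟨K, hK⟩ := (isCompact_Icc (a := (0:ℝ)) (b := 2)).exists_bound_of_continuousOn
    hdst.continuousOn
  have hK0 : 0 ≤ K := (norm_nonneg _).trans (hK 0 (by simp))
  set ε : ℝ := 1 / (2 * (1 + 8 * K)) with hε
  have hε0 : 0 < ε := by positivity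
  have hcont : ContinuousAt (fderiv ℝ g) 0 :=
    (hg.self_of_nhds.fderiv_right (m := 0) (by simp)).continuousAt
  have hsm : ∀ᶠ u in 𝓝 (0:H), ‖fderiv ℝ g u‖ < ε :=
    hcont.norm.eventually_lt continuousAt_const (by simpa [dg0] using hε0)
  obtain ⟨ρ, hρ, hball⟩ := Metric.eventually_nhds_iff_ball.1 (hg.and hsm)
  have hgb : ∀ u ∈ Metric.ball (0:H) ρ, ‖g u‖ ≤ ε * ‖u‖ := by
    intro u hu
    have := (convex_ball (0:H) ρ).norm_image_sub_le_of_norm_fderiv_le (𝕜 := ℝ) (f := g) (C := ε)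
      (fun x hx => (hball x hx).1.differentiableAt (by simp)) (fun x hx => (hball x hx).2.le)
      (Metric.mem_ball_self hρ) hu
    simpa [g0] using this
  obtain ⟨δ, hδ, hδρ, hδr⟩ : ∃ δ : ℝ, 0 < δ ∧ 2 * δ < ρ ∧ 2 * δ < r₁ := by
    refine ⟨min ρ r₁ / 3, by positivity, ?_, ?_⟩
    · linarith [min_le_left ρ r₁, lt_min hρ hr₁]
    · linarith [min_le_right ρ r₁, lt_min hρ hr₁]
  let χ : H → ℝ := fun u => Real.smoothTransition (2 - ‖u‖ ^ 2 / δ ^ 2)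
  have hχ : ContDiff ℝ ∞ χ := hst.comp (contDiff_const.sub ((contDiff_norm_sq ℝ).div_const _))
  have hχ0 : ∀ u, 2 * δ ^ 2 ≤ ‖u‖ ^ 2 → χ u = 0 := by
    intro u hu
    apply Real.smoothTransition.zero_of_nonpos
    have : 2 ≤ ‖u‖ ^ 2 / δ ^ 2 := by rw [le_div_iff₀ (by positivity)]; exact hu
    linarith
  have hχ1 : ∀ u, ‖u‖ ≤ δ → χ u = 1 := by
    intro u hu
    apply Real.smoothTransition.one_of_one_le
    have : ‖u‖ ^ 2 / δ ^ 2 ≤ 1 := by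
      rw [div_le_one (by positivity)]; gcongr
    linarith
  have hdχ : ∀ u, ‖u‖ ^ 2 ≤ 2 * δ ^ 2 → ‖fderiv ℝ χ u‖ ≤ 4 * K / δ := by
    intro u hu
    have hu2 : ‖u‖ ≤ 2 * δ := by
      apply le_of_sq_le_sq _ (by positivity)
      nlinarith [sq_nonneg δ]
    have h1 : HasFDerivAt (fun u : H => 2 - ‖u‖ ^ 2 / δ ^ 2)
        (-((δ ^ 2)⁻¹ • ((2:ℝ) • innerSL ℝ u))) u := by
      have := ((hasStrictFDerivAt_norm_sq u).hasFDerivAt.const_mul ((δ ^ 2)⁻¹)).const_sub (2:ℝ)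
      refine HasFDerivAt.congr_fderiv (this.congr_of_eventuallyEq ?_) ?_
      · exact Filter.Eventually.of_forall fun x => by simp [div_eq_inv_mul]
      · ext v; simp [two_smul]
    have h2 : HasDerivAt Real.smoothTransition (deriv Real.smoothTransition (2 - ‖u‖ ^ 2 / δ ^ 2))
        (2 - ‖u‖ ^ 2 / δ ^ 2) := (hst.differentiable (by simp) _).hasDerivAt
    have h3 := (h2.comp_hasFDerivAt u h1).fderiv
    change fderiv ℝ χ u = _ at h3
    rw [h3, norm_smul, norm_neg, norm_smul, norm_smul, innerSL_apply_norm]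
    have h4 : ‖deriv Real.smoothTransition (2 - ‖u‖ ^ 2 / δ ^ 2)‖ ≤ K := by
      apply hK
      have : ‖u‖ ^ 2 / δ ^ 2 ≤ 2 := by rw [div_le_iff₀ (by positivity)]; exact hu
      have : 0 ≤ ‖u‖ ^ 2 / δ ^ 2 := by positivity
      constructor <;> linarith
    calc _ ≤ K * ((δ ^ 2)⁻¹ * (2 * (2 * δ))) := by
          gcongr
          · simp
          · simp
      _ = 4 * K / δ := by field_simp; norm_num
  let ψ : H → H := fun u => χ u • g u
  have hψ0 : ∀ u, 2 * δ ^ 2 ≤ ‖u‖ ^ 2 → ψ u = 0 := fun u hu => by simp [ψ, hχ0 u hu]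
  have hloc0 : ∀ u : H, 2 * δ ^ 2 < ‖u‖ ^ 2 → ψ =ᶠ[𝓝 u] fun _ => 0 := by
    intro u hu
    have : ∀ᶠ v in 𝓝 u, 2 * δ ^ 2 < ‖v‖ ^ 2 :=
      continuousAt_const.eventually_lt (by fun_prop) hu
    filter_upwards [this] with v hv using hψ0 v hv.le
  have hin : ∀ u : H, ‖u‖ ^ 2 ≤ 2 * δ ^ 2 → ‖u‖ ≤ 2 * δ := by
    intro u hu
    apply le_of_sq_le_sq _ (by positivity)
    nlinarith [sq_nonneg δ]
  have hinb : ∀ u : H, ‖u‖ ^ 2 ≤ 2 * δ ^ 2 → u ∈ Metric.ball (0:H) ρ := by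
    intro u hu
    rw [mem_ball_zero_iff]
    linarith [hin u hu]
  refine ⟨δ, ψ, hδ, ?_, ?_, ?_, ?_⟩
  · rw [contDiff_iff_contDiffAt]
    intro u
    rcases le_or_gt (‖u‖ ^ 2) (2 * δ ^ 2) with hu | hu
    · exact hχ.contDiffAt.smul (hball u (hinb u hu)).1
    · exact contDiffAt_const.congr_of_eventuallyEq (hloc0 u hu)
  · intro u
    rcases le_or_gt (‖u‖ ^ 2) (2 * δ ^ 2) with hu | hu
    · have hgu := (hball u (hinb u hu))
      have h1 := fderiv_smul (𝕜 := ℝ) (x := u) (hχ.differentiable (by simp) u)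
        (hgu.1.differentiableAt (by simp))
      change fderiv ℝ ψ u = _ at h1
      rw [h1]
      have hχn : ‖χ u‖ ≤ 1 := by
        rw [Real.norm_of_nonneg (Real.smoothTransition.nonneg _)]
        exact Real.smoothTransition.le_one _
      calc _ ≤ ‖χ u • fderiv ℝ g u‖ + ‖(fderiv ℝ χ u).smulRight (g u)‖ := norm_add_le _ _
        _ = ‖χ u‖ * ‖fderiv ℝ g u‖ + ‖fderiv ℝ χ u‖ * ‖g u‖ := by
          rw [norm_smul, ContinuousLinearMap.norm_smulRight_apply]
        _ ≤ 1 * ε + (4 * K / δ) * (ε * (2 * δ)) := by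
          have h5 := hgb u (hinb u hu)
          have h6 := hdχ u hu
          have h7 := hgu.2.le
          have h8 := hin u hu
          have h9 : ‖g u‖ ≤ ε * (2 * δ) := h5.trans (by gcongr)
          gcongr
        _ = 1 / 2 := by rw [hε]; field_simp; ring
    · rw [(hloc0 u hu).fderiv_eq]; simp
  · intro u hu
    apply hψ0
    have : 2 * δ ≤ ‖u‖ := by linarith
    nlinarith [sq_nonneg δ]
  · intro u hu
    simp [ψ, hχ1 u hu]

theorem aux_dual {H : Type u} [NormedAddCommGroup H] [InnerProductSpace ℝ H] [CompleteSpace H] :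
    ∃ T : (H →L[ℝ] ℝ) →L[ℝ] H, ∀ l v, ⟪T l, v⟫ = l v := by
  let T₀ : (H →L[ℝ] ℝ) →ₗ[ℝ] H :=
    { toFun := fun l => (InnerProductSpace.toDual ℝ H).symm l
      map_add' := fun a b => by simp
      map_smul' := fun a b => by simp }
  refine ⟨T₀.mkContinuous 1 fun l => ?_, fun l v => ?_⟩
  · simp [T₀]
  · exact InnerProductSpace.toDual_symm_apply

theorem aux_taylor {H : Type u} [NormedAddCommGroup H] [InnerProductSpace ℝ H] [CompleteSpace H]
    (f : H → ℝ) (hf : ContDiff ℝ ∞ f) (hf0 : f 0 = 0) (hdf0 : fderiv ℝ f 0 = 0) :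
    ∃ M : H → H →L[ℝ] H →L[ℝ] ℝ, ContDiff ℝ ∞ M ∧ (∀ u x y, M u x y = M u y x) ∧
      M 0 = fderiv ℝ (fderiv ℝ f) 0 ∧ ∀ u, f u = 1 / 2 * M u u u := by
  have hf1 : ContDiff ℝ ∞ (fderiv ℝ f) := hf.fderiv_right (by simp)
  have hf2 : ContDiff ℝ ∞ (fderiv ℝ (fderiv ℝ f)) := hf1.fderiv_right (by simp)
  have hc2 := hf2.continuous
  let M : H → H →L[ℝ] H →L[ℝ] ℝ := fun u =>
    ∫ t in (0:ℝ)..1, (2 * (1 - t)) • fderiv ℝ (fderiv ℝ f) (t • u)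
  have hint : ∀ u : H, Continuous
      (fun t : ℝ => (2 * (1 - t)) • fderiv ℝ (fderiv ℝ f) (t • u)) :=
    fun u => by fun_prop
  have hint' : ∀ u x : H, IntervalIntegrable
      (fun t : ℝ => ((2 * (1 - t)) • fderiv ℝ (fderiv ℝ f) (t • u)) x) MeasureTheory.volume 0 1 :=
    fun u x => Continuous.intervalIntegrable (by fun_prop) _ _
  have happ : ∀ u x y, M u x y =
      ∫ t in (0:ℝ)..1, (2 * (1 - t)) * fderiv ℝ (fderiv ℝ f) (t • u) x y := by
    intro u x y
    simp only [M]
    rw [ContinuousLinearMap.intervalIntegral_apply ((hint u).intervalIntegrable 0 1),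
      ContinuousLinearMap.intervalIntegral_apply (hint' u x)]
    simp
  refine ⟨M, ?_, ?_, ?_, ?_⟩
  · rw [contDiff_infty]
    intro n
    exact aux_contDiff_radial n (fun t => 2 * (1 - t)) (by fun_prop) _ hf2
  · intro u x y
    rw [happ, happ]
    have h2 : minSmoothness ℝ 2 ≤ (∞ : ℕ∞ω) := by
      rw [minSmoothness_of_isRCLikeNormedField]
      exact WithTop.coe_le_coe.2 le_top
    congr 1
    ext t
    rw [(hf.contDiffAt (x := t • u)).isSymmSndFDerivAt h2 x y]
  · ext x y
    rw [happ]
    simp only [smul_zero]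
    rw [intervalIntegral.integral_mul_const]
    have : ∫ t in (0:ℝ)..1, 2 * (1 - t) = 1 := by
      rw [intervalIntegral.integral_const_mul, intervalIntegral.integral_sub (by simp) (by simp)]
      simp
      norm_num
    rw [this, one_mul]
  · intro u
    rw [happ]
    have hl : ∀ t : ℝ, HasDerivAt (fun t : ℝ => t • u) u t := fun t => by
      simpa using (hasDerivAt_id t).smul_const u
    have hd : ∀ t : ℝ, HasDerivAt (fun t : ℝ => 2 * ((1 - t) * fderiv ℝ f (t • u) u + f (t • u)))
        ((2 * (1 - t)) * fderiv ℝ (fderiv ℝ f) (t • u) u u) t := by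
      intro t
      have h1 : HasDerivAt (fun t : ℝ => f (t • u)) (fderiv ℝ f (t • u) u) t :=
        (hf.differentiable (by simp) (t • u)).hasFDerivAt.comp_hasDerivAt t (hl t)
      have h2 : HasDerivAt (fun t : ℝ => fderiv ℝ f (t • u)) (fderiv ℝ (fderiv ℝ f) (t • u) u) t :=
        (hf1.differentiable (by simp) (t • u)).hasFDerivAt.comp_hasDerivAt t (hl t)
      have h3 : HasDerivAt (fun t : ℝ => fderiv ℝ f (t • u) u)
          (fderiv ℝ (fderiv ℝ f) (t • u) u u) t := by
        simpa using h2.clm_apply (hasDerivAt_const t u)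
      have h4 := ((((hasDerivAt_id t).const_sub 1).mul h3).add h1).const_mul 2
      refine h4.congr_deriv ?_
      simp
      ring
    rw [intervalIntegral.integral_eq_sub_of_hasDerivAt (fun t _ => hd t)
      (Continuous.intervalIntegrable (by fun_prop) _ _)]
    simp [hf0, hdf0]

theorem aux_local {H : Type u} [NormedAddCommGroup H] [InnerProductSpace ℝ H] [CompleteSpace H]
    (f : H → ℝ) (hf : ContDiff ℝ ∞ f) (hf0 : f 0 = 0) (hdf0 : fderiv ℝ f 0 = 0)
    (B : H ≃L[ℝ] H) (hBsym : ∀ u v : H, ⟪B u, v⟫ = ⟪u, B v⟫)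
    (hBhess : ∀ u v : H, (fderiv ℝ (fderiv ℝ f) 0) u v = ⟪B u, v⟫) :
    ∃ g : H → H, (∀ᶠ u in 𝓝 0, ContDiffAt ℝ ∞ g u) ∧ g 0 = 0 ∧ fderiv ℝ g 0 = 0 ∧
      ∀ᶠ u in 𝓝 0, f u = 1 / 2 * ⟪B (u + g u), u + g u⟫ := by
  obtain ⟨M, hM, hMs, hM0, hMf⟩ := aux_taylor f hf hf0 hdf0
  obtain ⟨T, hT⟩ := aux_dual (H := H)
  obtain ⟨S, hS1, hSω, hSr, hSl⟩ := aux_sqrt (R := H →L[ℝ] H)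
  let C : H → H →L[ℝ] H := fun u => ((B.symm : H →L[ℝ] H) ∘L T) ∘L M u
  have hC : ContDiff ℝ ∞ C := contDiff_const.clm_comp hM
  have hBC : ∀ u x y, ⟪B (C u x), y⟫ = M u x y := by
    intro u x y
    simp [C, hT]
  have hC0 : C 0 = 1 := by
    ext x
    apply B.injective
    apply ext_inner_right ℝ
    intro y
    rw [hBC, hM0, hBhess]
    simp
  have hCt : Filter.Tendsto C (𝓝 0) (𝓝 1) := by
    have := hC.continuous.tendsto 0
    rwa [hC0] at this
  let R : H → H →L[ℝ] H := fun u => S (C u)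
  have hR0 : R 0 = 1 := by simp [R, hC0, hS1]
  have hR : ∀ᶠ u in 𝓝 0, ContDiffAt ℝ ∞ R u := by
    filter_upwards [hCt.eventually (hSω.eventually (by simp))] with u hu
    exact ContDiffAt.comp u (hu.of_le (by simp)) hC.contDiffAt
  let Q : H → H →L[ℝ] H := fun u =>
    (B.symm : H →L[ℝ] H) ∘L (ContinuousLinearMap.adjoint (R u)) ∘L (B : H →L[ℝ] H)
  have hQ0 : Q 0 = 1 := by
    ext x
    simp [Q, hR0, ← ContinuousLinearMap.star_eq_adjoint]
  have hQc : ContinuousAt Q 0 := by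
    have h1 : ContinuousAt (fun u => ContinuousLinearMap.adjoint (R u)) 0 :=
      (ContinuousLinearMap.adjoint (𝕜 := ℝ) (E := H) (F := H)).continuous.continuousAt.comp
        hR.self_of_nhds.continuousAt
    exact continuousAt_const.clm_comp (h1.clm_comp continuousAt_const)
  have hQt : Filter.Tendsto Q (𝓝 0) (𝓝 1) := by
    have := hQc.tendsto
    rwa [hQ0] at this
  have hBQ : ∀ u x y, ⟪B (Q u x), y⟫ = ⟪B x, R u y⟫ := by
    intro u x y
    simp [Q, ContinuousLinearMap.adjoint_inner_left]
  have hRR : ∀ᶠ u in 𝓝 0, R u * R u = C u := hCt.eventually hSr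
  have hQR : ∀ᶠ u in 𝓝 0, Q u = R u := by
    filter_upwards [hRR, hQt.eventually hSl] with u h1 h2
    have h3 : Q u * Q u = C u := by
      ext x
      apply B.injective
      apply ext_inner_right ℝ
      intro y
      have h4 : R u (R u y) = C u y := by rw [← h1]; rfl
      change ⟪B (Q u (Q u x)), y⟫ = _
      rw [hBQ, hBQ, h4, hBC, real_inner_comm, ← hBsym, hBC, hMs]
    rw [← h2, h3]
  let g : H → H := fun u => R u u - u
  have hg0 : g 0 = 0 := by simp [g]
  refine ⟨g, ?_, hg0, ?_, ?_⟩
  · filter_upwards [hR] with u hu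
    exact (hu.clm_apply contDiffAt_id).sub contDiffAt_id
  · have h1 := (hR.self_of_nhds.differentiableAt (by simp)).hasFDerivAt
    have h2 := (h1.clm_apply (hasFDerivAt_id (0:H))).sub (hasFDerivAt_id (0:H))
    refine HasFDerivAt.fderiv (f := g) (h2.congr_fderiv ?_)
    ext v
    simp [hR0]
  · filter_upwards [hRR, hQR] with u h1 h2
    have h3 : u + g u = R u u := by simp [g]
    rw [h3, hMf u, ← hBC, ← h1]
    congr 1
    change ⟪B (R u (R u u)), u⟫ = _
    rw [← hBQ, h2]

/-- Lemma 4, an addendum to the Morse lemma: if `f` is smooth with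
`f(0) = 0`, `Df(0) = 0` and `D²f(0)[u,v] = ⟨Au,v⟩` for a bounded invertible self-adjoint
operator `A`, then for every `r₁ > 0` there are `r₀ > 0` and a smooth diffeomorphism `φ`
of `H` supported in the ball of radius `r₁`, with `φ(0) = 0`, `Dφ(0) = I`, and
`f(u) = ½ ⟨A φ(u), φ(u)⟩` for `‖u‖ ≤ r₀`. -/
theorem morse_lemma_with_compactly_supported_diffeo
    {H : Type*} [NormedAddCommGroup H] [InnerProductSpace ℝ H] [CompleteSpace H]
    (f : H → ℝ) (hf : ContDiff ℝ (⊤ : ℕ∞) f) (hf0 : f 0 = 0)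
    (hdf0 : fderiv ℝ f 0 = 0)
    (A : H →L[ℝ] H)
    (hAsym : ∀ u v : H, ⟪A u, v⟫ = ⟪u, A v⟫)
    (hAinv : ∃ B : H ≃L[ℝ] H, (B : H →L[ℝ] H) = A)
    (hAhess : ∀ u v : H, (fderiv ℝ (fderiv ℝ f) 0) u v = ⟪A u, v⟫)
    (r₁ : ℝ) (hr₁ : 0 < r₁) :
    ∃ (r₀ : ℝ) (φ φinv : H → H), 0 < r₀ ∧
      ContDiff ℝ (⊤ : ℕ∞) φ ∧ ContDiff ℝ (⊤ : ℕ∞) φinv ∧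
      Function.LeftInverse φinv φ ∧ Function.RightInverse φinv φ ∧
      (∀ u : H, r₁ ≤ ‖u‖ → φ u = u) ∧
      φ 0 = 0 ∧ fderiv ℝ φ 0 = ContinuousLinearMap.id ℝ H ∧
      (∀ u : H, ‖u‖ ≤ r₀ → f u = (1 / 2) * ⟪A (φ u), φ u⟫) := by

  obtain ⟨B, rfl⟩ := hAinv
  obtain ⟨g, hg, hg0, hdg0, hfg⟩ := aux_local f hf hf0 hdf0 B hAsym hAhess
  obtain ⟨ρ, hρ, hball⟩ := Metric.eventually_nhds_iff_ball.1 hfg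
  obtain ⟨r, ψ, hr, hψ, hψb, hψ0, hψg⟩ := aux_cutoff g hg hg0 hdg0 r₁ hr₁
  obtain ⟨φinv, hinv, hl, hr'⟩ := aux_global ψ hψ hψb
  have hψz : ψ 0 = 0 := by rw [hψg 0 (by simpa using hr.le), hg0]
  have hloc : ψ =ᶠ[𝓝 0] g := by
    filter_upwards [Metric.closedBall_mem_nhds (0:H) hr] with u hu
    exact hψg u (by simpa using hu)
  refine ⟨min r (ρ / 2), fun u => u + ψ u, φinv, by positivity, contDiff_id.add hψ, hinv, hl, hr',
    ?_, ?_, ?_, ?_⟩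
  · intro u hu
    simp [hψ0 u hu]
  · simp [hψz]
  · have h1 := (hasFDerivAt_id (𝕜 := ℝ) (0:H)).add
      (hψ.differentiable (by simp) 0).hasFDerivAt
    refine HasFDerivAt.fderiv (f := fun u => u + ψ u) (h1.congr_fderiv ?_)
    rw [hloc.fderiv_eq, hdg0, add_zero]
  · intro u hu
    have h1 : u ∈ Metric.ball (0:H) ρ := by
      rw [mem_ball_zero_iff]
      linarith [hu.trans (min_le_right _ _)]
    have h2 := hψg u (hu.trans (min_le_left _ _))
    simp only [h2]
    exact hball u h1
end

section
/- Let H be a real Hilbert space and let u, v ∈ H satisfy ⟨u,v⟩ > 0. Then the bounded linear operator L(u,v) on H defined by L(u,v)w = w − (⟨w,u⟩/‖u‖²)u + (⟨w,v⟩/⟨u,v⟩)v is positive definite (⟨L(u,v)w, w⟩ > 0 for every w ≠ 0) and invertible, with bounded inverse. -/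
open RealInnerProductSpace

/-- part of Lemma 3.5 of the paper: for `u, v` with `⟨u,v⟩ > 0`, the
operator `L(u,v) w = w − (⟨w,u⟩/‖u‖²) u + (⟨w,v⟩/⟨u,v⟩) v` is positive definite and
invertible with bounded inverse. -/
theorem Lop_positive_invertible
    {H : Type*} [NormedAddCommGroup H] [InnerProductSpace ℝ H] [CompleteSpace H]
    (u v : H) (huv : 0 < ⟪u, v⟫)
    (L : H →L[ℝ] H)
    (hL : ∀ w : H, L w = w - (⟪w, u⟫ / ‖u‖ ^ 2) • u + (⟪w, v⟫ / ⟪u, v⟫) • v) :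
    (∀ w : H, w ≠ 0 → 0 < ⟪L w, w⟫) ∧
      ∃ E : H ≃L[ℝ] H, (E : H →L[ℝ] H) = L := by
  have hu : u ≠ 0 := by
    rintro rfl
    simp at huv
  have hU : ‖u‖ ^ 2 ≠ 0 := by
    have := norm_pos_iff.mpr hu
    positivity
  have hs : ⟪u, v⟫ ≠ 0 := huv.ne'
  have hpos : ∀ w : H, w ≠ 0 → 0 < ⟪L w, w⟫ := by
    intro w hw
    have key : ⟪L w, w⟫ = ‖w - (⟪w, u⟫ / ‖u‖ ^ 2) • u‖ ^ 2 + ⟪w, v⟫ ^ 2 / ⟪u, v⟫ := by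
      rw [hL, ← real_inner_self_eq_norm_sq (w - _)]
      simp only [inner_add_left, inner_sub_left, inner_sub_right, real_inner_smul_left,
        real_inner_smul_right, real_inner_self_eq_norm_sq, norm_smul, mul_pow,
        Real.norm_eq_abs, sq_abs]
      rw [real_inner_comm w u, real_inner_comm w v]
      field_simp
      ring
    rw [key]
    by_cases hp : w - (⟪w, u⟫ / ‖u‖ ^ 2) • u = 0
    · have hw' : w = (⟪w, u⟫ / ‖u‖ ^ 2) • u := sub_eq_zero.mp hp
      have hb : ⟪w, v⟫ ≠ 0 := by
        rw [hw', real_inner_smul_left]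
        refine mul_ne_zero ?_ hs
        intro h
        rw [h, zero_smul] at hw'
        exact hw hw'
      positivity
    · have := norm_pos_iff.mpr hp
      positivity
  refine ⟨hpos, ?_⟩
  have hinj : L.ker = ⊥ := by
    refine LinearMap.ker_eq_bot'.mpr fun w hw => ?_
    by_contra h
    have h1 := hpos w h
    have h2 : L w = 0 := hw
    rw [h2, inner_zero_left] at h1
    exact lt_irrefl _ h1
  have hsurj : L.range = ⊤ := by
    refine LinearMap.range_eq_top.mpr fun w => ?_
    refine ⟨w - (⟪w, u⟫ / ⟪u, v⟫) • v + (⟪w, u⟫ / ⟪u, v⟫ - ⟪w, v⟫ / ⟪u, v⟫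
      + ‖v‖ ^ 2 * ⟪w, u⟫ / ⟪u, v⟫ ^ 2) • u, ?_⟩
    change L _ = w
    rw [hL]
    simp only [inner_add_left, inner_sub_left, real_inner_smul_left, real_inner_self_eq_norm_sq]
    rw [real_inner_comm u v]
    match_scalars <;> field_simp <;> ring
  exact ⟨ContinuousLinearEquiv.ofBijective L hinj hsurj, ContinuousLinearEquiv.coe_ofBijective L hinj hsurj⟩
end

section
/- Let H be a real Hilbert space and let u, v ∈ H satisfy ⟨u,v⟩ > 0. Then the operator norm of the bounded linear operator L(u,v) defined by L(u,v)w = w − (⟨w,u⟩/‖u‖²)u + (⟨w,v⟩/⟨u,v⟩)v satisfies ‖L(u,v)‖ ≤ 1 + ‖v‖²/⟨u,v⟩. -/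
open RealInnerProductSpace

/-- first estimate in Lemma 3.5 of the paper: for `u, v` with
`⟨u,v⟩ > 0`, the operator `L(u,v) w = w − (⟨w,u⟩/‖u‖²) u + (⟨w,v⟩/⟨u,v⟩) v` satisfies
`‖L(u,v)‖ ≤ 1 + ‖v‖²/⟨u,v⟩`. -/
theorem Lop_norm_bound
    {H : Type*} [NormedAddCommGroup H] [InnerProductSpace ℝ H] [CompleteSpace H]
    (u v : H) (huv : 0 < ⟪u, v⟫)
    (L : H →L[ℝ] H)
    (hL : ∀ w : H, L w = w - (⟪w, u⟫ / ‖u‖ ^ 2) • u + (⟪w, v⟫ / ⟪u, v⟫) • v) :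
    ‖L‖ ≤ 1 + ‖v‖ ^ 2 / ⟪u, v⟫ := by
  have hu : u ≠ 0 := by
    rintro rfl
    simp at huv
  have hu' : 0 < ‖u‖ := norm_pos_iff.mpr hu
  refine ContinuousLinearMap.opNorm_le_bound _ (by positivity) fun w => ?_
  have h1 : ‖w - (⟪w, u⟫ / ‖u‖ ^ 2) • u‖ ≤ ‖w‖ := by
    apply (sq_le_sq₀ (norm_nonneg _) (norm_nonneg _)).mp
    rw [norm_sub_sq_real, inner_smul_right, norm_smul, mul_pow, Real.norm_eq_abs, sq_abs]
    have h : ‖w‖ ^ 2 - 2 * (⟪w, u⟫ / ‖u‖ ^ 2 * ⟪w, u⟫) + (⟪w, u⟫ / ‖u‖ ^ 2) ^ 2 * ‖u‖ ^ 2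
        = ‖w‖ ^ 2 - (⟪w, u⟫ / ‖u‖) ^ 2 := by
      field_simp
      ring
    rw [h]
    linarith [sq_nonneg (⟪w, u⟫ / ‖u‖)]
  have h2 : ‖(⟪w, v⟫ / ⟪u, v⟫) • v‖ ≤ ‖v‖ ^ 2 / ⟪u, v⟫ * ‖w‖ := by
    rw [norm_smul, Real.norm_eq_abs, abs_div, abs_of_pos huv]
    calc |⟪w, v⟫| / ⟪u, v⟫ * ‖v‖ ≤ (‖w‖ * ‖v‖) / ⟪u, v⟫ * ‖v‖ := by
          gcongr
          exact abs_real_inner_le_norm w v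
      _ = ‖v‖ ^ 2 / ⟪u, v⟫ * ‖w‖ := by ring
  rw [hL]
  calc _ ≤ _ := norm_add_le _ _
    _ ≤ _ := add_le_add h1 h2
    _ = _ := by ring
end

section
/- Let H be a real Hilbert space and let u, v ∈ H satisfy ⟨u,v⟩ > 0. Then the bounded linear operator L(u,v) defined by L(u,v)w = w − (⟨w,u⟩/‖u‖²)u + (⟨w,v⟩/⟨u,v⟩)v is invertible, and its inverse satisfies the operator norm bound ‖L(u,v)⁻¹‖ ≤ (1 + ‖u‖‖v‖/⟨u,v⟩)² + ‖u‖²/⟨u,v⟩. -/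
open RealInnerProductSpace

/-- second estimate in Lemma 3.5 of the paper: for `u, v` with
`⟨u,v⟩ > 0`, the operator `L(u,v) w = w − (⟨w,u⟩/‖u‖²) u + (⟨w,v⟩/⟨u,v⟩) v` is invertible
and `‖L(u,v)⁻¹‖ ≤ (1 + ‖u‖‖v‖/⟨u,v⟩)² + ‖u‖²/⟨u,v⟩`. -/
theorem Lop_inverse_norm_bound
    {H : Type*} [NormedAddCommGroup H] [InnerProductSpace ℝ H] [CompleteSpace H]
    (u v : H) (huv : 0 < ⟪u, v⟫)
    (L : H →L[ℝ] H)
    (hL : ∀ w : H, L w = w - (⟪w, u⟫ / ‖u‖ ^ 2) • u + (⟪w, v⟫ / ⟪u, v⟫) • v) :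
    ∃ E : H ≃L[ℝ] H, (E : H →L[ℝ] H) = L ∧
      ‖(E.symm : H →L[ℝ] H)‖ ≤ (1 + ‖u‖ * ‖v‖ / ⟪u, v⟫) ^ 2 + ‖u‖ ^ 2 / ⟪u, v⟫ := by
  have hu : u ≠ 0 := by
    rintro rfl
    simp at huv
  have hn : 0 < ‖u‖ := norm_pos_iff.mpr hu
  have hn' : ‖u‖ ≠ 0 := hn.ne'
  set c : ℝ := ⟪u, v⟫ with hc
  have hc' : c ≠ 0 := huv.ne'
  have hvu : ⟪v, u⟫ = c := by rw [hc, real_inner_comm]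
  have huu : ⟪u, u⟫ = ‖u‖ ^ 2 := real_inner_self_eq_norm_sq u
  let R : H → H → (H →L[ℝ] H) := fun x y => c⁻¹ • (innerSL ℝ x).smulRight y
  have hR : ∀ x y, ‖R x y‖ ≤ ‖x‖ * ‖y‖ / c := by
    intro x y
    simp only [R, norm_smul, ContinuousLinearMap.norm_smulRight_apply, innerSL_apply_norm,
      norm_inv, Real.norm_of_nonneg huv.le]
    exact le_of_eq (by ring)
  have hP : ∀ x y, ‖ContinuousLinearMap.id ℝ H - R x y‖ ≤ 1 + ‖x‖ * ‖y‖ / c := by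
    intro x y
    exact (norm_sub_le _ _).trans (add_le_add ContinuousLinearMap.norm_id_le (hR x y))
  let M : H →L[ℝ] H := (ContinuousLinearMap.id ℝ H - R v u).comp
    (ContinuousLinearMap.id ℝ H - R u v) + R u u
  have hM : ∀ z, M z = z - (c⁻¹ * ⟪u, z⟫) • v
      - (c⁻¹ * (⟪v, z⟫ - c⁻¹ * ⟪u, z⟫ * ⟪v, v⟫)) • u + (c⁻¹ * ⟪u, z⟫) • u := by
    intro z
    simp [M, R, smul_smul, mul_assoc]
    module
  have hl : Function.LeftInverse M L := by
    intro w
    rw [hM, hL]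
    simp only [inner_sub_right, inner_add_right, inner_smul_right, hvu, huu, ← hc,
      real_inner_comm w u, real_inner_comm w v]
    match_scalars <;> field_simp <;> ring
  have hr : Function.RightInverse M L := by
    intro z
    rw [hL, hM]
    simp only [inner_sub_left, inner_add_left, inner_smul_left, hvu, huu, ← hc,
      real_inner_comm u z, real_inner_comm v z, RCLike.conj_to_real]
    match_scalars <;> field_simp <;> ring
  refine ⟨ContinuousLinearEquiv.equivOfInverse L M hl hr, ?_, ?_⟩
  · ext w
    rfl
  · have : ((ContinuousLinearEquiv.equivOfInverse L M hl hr).symm : H →L[ℝ] H) = M := by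
      ext w
      rfl
    rw [this]
    refine (norm_add_le _ _).trans (add_le_add ?_ ?_)
    · refine (ContinuousLinearMap.opNorm_comp_le _ _).trans ?_
      rw [pow_two]
      have h1 := hP v u
      rw [mul_comm ‖v‖] at h1
      exact mul_le_mul h1 (hP u v) (norm_nonneg _) (by positivity)
    · rw [pow_two]
      exact hR u u
end

section
/- Let H be a real Hilbert space, let θ ∈ [0,1), and let u, v ∈ H with v ≠ 0 and ‖u − v‖ ≤ θ‖v‖. Then ⟨u,v⟩ > 0, so the bounded linear operator L(u,v) defined by L(u,v)w = w − (⟨w,u⟩/‖u‖²)u + (⟨w,v⟩/⟨u,v⟩)v is defined, and it satisfies the operator norm bounds ‖L(u,v)‖ ≤ 1 + 1/(1−θ) and ‖L(u,v)⁻¹‖ ≤ 4/(1−θ)² + (1+θ)²/(1−θ). -/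
open RealInnerProductSpace

/-- the uniform estimates used in Section 3 of the paper: if
`θ ∈ [0,1)`, `v ≠ 0` and `‖u − v‖ ≤ θ‖v‖`, then `⟨u,v⟩ > 0`, so the operator
`L(u,v) w = w − (⟨w,u⟩/‖u‖²) u + (⟨w,v⟩/⟨u,v⟩) v` is defined, and it satisfies
`‖L(u,v)‖ ≤ 1 + 1/(1−θ)` and `‖L(u,v)⁻¹‖ ≤ 4/(1−θ)² + (1+θ)²/(1−θ)`. -/
theorem Lop_uniform_bounds
    {H : Type*} [NormedAddCommGroup H] [InnerProductSpace ℝ H] [CompleteSpace H]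
    (θ : ℝ) (hθ0 : 0 ≤ θ) (hθ1 : θ < 1)
    (u v : H) (hv : v ≠ 0) (huv : ‖u - v‖ ≤ θ * ‖v‖) :
    0 < ⟪u, v⟫ ∧
      ∀ L : H →L[ℝ] H,
        (∀ w : H, L w = w - (⟪w, u⟫ / ‖u‖ ^ 2) • u + (⟪w, v⟫ / ⟪u, v⟫) • v) →
        ‖L‖ ≤ 1 + 1 / (1 - θ) ∧
        ∃ E : H ≃L[ℝ] H, (E : H →L[ℝ] H) = L ∧
          ‖(E.symm : H →L[ℝ] H)‖ ≤ 4 / (1 - θ) ^ 2 + (1 + θ) ^ 2 / (1 - θ) := by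
  have hq : 0 < ‖v‖ := norm_pos_iff.mpr hv
  have ht : 0 < 1 - θ := by linarith
  have hp : ‖u‖ ≤ (1 + θ) * ‖v‖ := by
    have h := norm_add_le (u - v) v
    rw [sub_add_cancel] at h
    linarith
  have hc1 : (1 - θ) * ‖v‖ ^ 2 ≤ ⟪u, v⟫ := by
    have h1 : ⟪u, v⟫ = ⟪u - v, v⟫ + ‖v‖ ^ 2 := by
      rw [inner_sub_left, real_inner_self_eq_norm_sq]; ring
    have h2 := (abs_le.mp (abs_real_inner_le_norm (u - v) v)).1
    have h3 := mul_le_mul_of_nonneg_right huv hq.le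
    nlinarith
  have hc : 0 < ⟪u, v⟫ := lt_of_lt_of_le (by positivity) hc1
  refine ⟨hc, ?_⟩
  intro L hL
  have hu : u ≠ 0 := by
    rintro rfl
    simp at hc
  have hpp : 0 < ‖u‖ := norm_pos_iff.mpr hu
  have huu : ⟪u, u⟫ = ‖u‖ ^ 2 := real_inner_self_eq_norm_sq u
  have hvv : ⟪v, v⟫ = ‖v‖ ^ 2 := real_inner_self_eq_norm_sq v
  have hvu : ⟪v, u⟫ = ⟪u, v⟫ := real_inner_comm _ _
  generalize hcd : ⟪u, v⟫ = c at *
  have hc0 : c ≠ 0 := hc.ne'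
  have hp0 : ‖u‖ ≠ 0 := hpp.ne'
  constructor
  · refine L.opNorm_le_bound (by positivity) fun w => ?_
    rw [hL]
    have h1 : ‖w - (⟪w, u⟫ / ‖u‖ ^ 2) • u‖ ≤ ‖w‖ := by
      refine le_of_sq_le_sq ?_ (norm_nonneg _)
      rw [norm_sub_sq_real, inner_smul_right, norm_smul, mul_pow, Real.norm_eq_abs, sq_abs]
      have : ‖w‖ ^ 2 - 2 * (⟪w, u⟫ / ‖u‖ ^ 2 * ⟪w, u⟫) + (⟪w, u⟫ / ‖u‖ ^ 2) ^ 2 * ‖u‖ ^ 2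
          = ‖w‖ ^ 2 - (⟪w, u⟫ / ‖u‖) ^ 2 := by
        field_simp; ring
      rw [this]
      linarith [sq_nonneg (⟪w, u⟫ / ‖u‖)]
    have h2 : ‖(⟪w, v⟫ / c) • v‖ ≤ 1 / (1 - θ) * ‖w‖ := by
      rw [norm_smul, Real.norm_eq_abs, abs_div, abs_of_pos hc]
      have h3 := abs_real_inner_le_norm w v
      rw [div_mul_eq_mul_div, div_mul_eq_mul_div, div_le_div_iff₀ hc ht]
      have h4 : |⟪w, v⟫| * ‖v‖ ≤ ‖w‖ * ‖v‖ * ‖v‖ := by gcongr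
      have h5 := mul_le_mul_of_nonneg_left hc1 (norm_nonneg w)
      nlinarith
    calc _ ≤ _ := norm_add_le _ _
      _ ≤ _ := by linarith
  · let M : H →L[ℝ] H := ContinuousLinearMap.id ℝ H
      + (((1 + ‖v‖ ^ 2 / c) / c) • (innerSL ℝ u) - (1 / c) • (innerSL ℝ v)).smulRight u
      - ((1 / c) • (innerSL ℝ u)).smulRight v
    have hM : ∀ z, M z = z + ((1 + ‖v‖ ^ 2 / c) / c * ⟪z, u⟫ - 1 / c * ⟪z, v⟫) • u
        - (1 / c * ⟪z, u⟫) • v := by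
      intro z
      simp [M, real_inner_comm]
    have hLM : ∀ w, M (L w) = w := by
      intro w
      rw [hM, hL]
      simp only [inner_add_left, inner_sub_left, real_inner_smul_left, huu, hvv, hvu, hcd]
      match_scalars <;> field_simp <;> ring
    have hML : ∀ w, L (M w) = w := by
      intro w
      rw [hL, hM]
      simp only [inner_add_left, inner_sub_left, real_inner_smul_left, huu, hvv, hvu, hcd]
      match_scalars <;> field_simp <;> ring
    refine ⟨ContinuousLinearEquiv.equivOfInverse L M hLM hML, by ext; rfl, ?_⟩
    refine ContinuousLinearMap.opNorm_le_bound _ (by positivity) fun z => ?_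
    change ‖M z‖ ≤ _
    have hr : ‖u‖ * ‖v‖ / c ≤ (1 + θ) / (1 - θ) := by
      rw [div_le_div_iff₀ hc ht]
      have h1 := mul_le_mul_of_nonneg_right hp hq.le
      have h2 := mul_le_mul_of_nonneg_right h1 ht.le
      have h3 := mul_le_mul_of_nonneg_left hc1 (by linarith : 0 ≤ 1 + θ)
      nlinarith
    have hs : ‖u‖ ^ 2 / c ≤ (1 + θ) ^ 2 / (1 - θ) := by
      rw [div_le_div_iff₀ hc ht]
      have h1 : ‖u‖ ^ 2 ≤ ((1 + θ) * ‖v‖) ^ 2 := by gcongr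
      have h2 := mul_le_mul_of_nonneg_right h1 ht.le
      have h3 := mul_le_mul_of_nonneg_left hc1 (sq_nonneg (1 + θ))
      nlinarith
    have hr2 : (1 + ‖u‖ * ‖v‖ / c) ^ 2 ≤ 4 / (1 - θ) ^ 2 := by
      have h1 : 1 + ‖u‖ * ‖v‖ / c ≤ 2 / (1 - θ) := by
        have : 2 / (1 - θ) = 1 + (1 + θ) / (1 - θ) := by field_simp; ring
        linarith
      calc _ ≤ (2 / (1 - θ)) ^ 2 := by gcongr
        _ = _ := by rw [div_pow]; norm_num
    have hzu := abs_real_inner_le_norm z u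
    have hzv := abs_real_inner_le_norm z v
    have hA : ‖((1 + ‖v‖ ^ 2 / c) / c * ⟪z, u⟫ - 1 / c * ⟪z, v⟫) • u‖
        ≤ ((1 + ‖v‖ ^ 2 / c) / c * (‖z‖ * ‖u‖) + 1 / c * (‖z‖ * ‖v‖)) * ‖u‖ := by
      rw [norm_smul, Real.norm_eq_abs]
      gcongr
      refine (abs_sub _ _).trans ?_
      rw [abs_mul, abs_mul, abs_of_pos (by positivity : 0 < (1 + ‖v‖ ^ 2 / c) / c),
        abs_of_pos (by positivity : 0 < 1 / c)]
      gcongr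
    have hB : ‖(1 / c * ⟪z, u⟫) • v‖ ≤ 1 / c * (‖z‖ * ‖u‖) * ‖v‖ := by
      rw [norm_smul, Real.norm_eq_abs, abs_mul, abs_of_pos (by positivity : 0 < 1 / c)]
      gcongr
    rw [hM]
    calc _ ≤ _ := norm_sub_le _ _
      _ ≤ _ := add_le_add_left (norm_add_le _ _) _
      _ ≤ ‖z‖ + ((1 + ‖v‖ ^ 2 / c) / c * (‖z‖ * ‖u‖) + 1 / c * (‖z‖ * ‖v‖)) * ‖u‖
          + 1 / c * (‖z‖ * ‖u‖) * ‖v‖ := by linarith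
      _ = ((1 + ‖u‖ * ‖v‖ / c) ^ 2 + ‖u‖ ^ 2 / c) * ‖z‖ := by field_simp; ring
      _ ≤ _ := by gcongr
end
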